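/- Let n ≥ 2, α ∈ (0,1), and let f : S^n → (0,∞) be a positive α-Hölder continuous function, extended to ℝ^{n+1}\{0} as a function homogeneous of degree −1. Let u : ℝ^{n+1} → ℝ be continuous, homogeneous of degree 1, of class C² on ℝ^{n+1}\{0}, and satisfy Δu = f on ℝ^{n+1}\{0}. Then u is convex on ℝ^{n+1} if and only if for all x, ξ ∈ S^n with ⟨ξ, x⟩ = 0, (1/ω_n) ∫_{ℝ^{n+1}} [ ( |x−y|² − (n+1)⟨ξ, y⟩² ) / |x−y|^{n+3} ] · ( f(y) − f(x)/|y| ) dy + f(x)/n ≥ 0, the integral being absolutely convergent. -/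

import Mathlib

open MeasureTheory Metric Set
open scoped RealInnerProductSpace

/-- The Euclidean Laplacian of `u : ℝ^m → ℝ`, as the sum of second partial
derivatives along the standard coordinate directions. -/
noncomputable def laplacian {m : ℕ} (u : EuclideanSpace ℝ (Fin m) → ℝ)
    (x : EuclideanSpace ℝ (Fin m)) : ℝ :=
  ∑ i, fderiv ℝ (fun y => fderiv ℝ u y (EuclideanSpace.single i 1)) x (EuclideanSpace.single i 1)

/-- `ω_n`, the total surface measure of the unit sphere `Sⁿ ⊂ ℝ^{n+1}`. -/
noncomputable def omega_n (n : ℕ) : ℝ :=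
  ((volume : Measure (EuclideanSpace ℝ (Fin (n + 1)))).toSphere Set.univ).toReal

section

open Filter Topology Module

/-- A radial cut-off, as a function of `p = ‖y‖ ^ 2`: it vanishes at `0` and at infinity and tends
to `1` on `(0, ∞)` as `d → 0`. -/
noncomputable def radialCutoff (d p : ℝ) : ℝ := p / (d + p + d * p ^ 2)

/-- The derivative of `radialCutoff d`. -/
noncomputable def radialCutoffDeriv (d p : ℝ) : ℝ :=
  d * (1 - p ^ 2) / (d + p + d * p ^ 2) ^ 2

lemma radialCutoff_den_pos {d p : ℝ} (hd : 0 < d) (hp : 0 ≤ p) : 0 < d + p + d * p ^ 2 := by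
  positivity

lemma hasDerivAt_radialCutoff {d p : ℝ} (hd : 0 < d) (hp : 0 ≤ p) :
    HasDerivAt (radialCutoff d) (radialCutoffDeriv d p) p := by
  have h0 := (radialCutoff_den_pos hd hp).ne'
  have h1 : HasDerivAt (fun p : ℝ => d + p + d * p ^ 2) (1 + d * (2 * p)) p := by
    exact (((hasDerivAt_id' p).const_add d).fun_add
      (((hasDerivAt_id' p).fun_pow 2).const_mul d)).congr_deriv (by norm_num)
  refine ((hasDerivAt_id' p).div h1 h0).congr_deriv ?_
  rw [radialCutoffDeriv]
  congr 1
  ring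

lemma continuous_radialCutoff_normSq {E : Type*} [NormedAddCommGroup E] {d : ℝ} (hd : 0 < d) :
    Continuous fun y : E => radialCutoff d (‖y‖ ^ 2) := by
  unfold radialCutoff
  refine Continuous.div (by fun_prop) (by fun_prop) fun y => ?_
  exact (radialCutoff_den_pos hd (by positivity)).ne'

lemma continuous_radialCutoffDeriv_normSq {E : Type*} [NormedAddCommGroup E] {d : ℝ}
    (hd : 0 < d) : Continuous fun y : E => radialCutoffDeriv d (‖y‖ ^ 2) := by
  unfold radialCutoffDeriv
  refine Continuous.div (by fun_prop) (by fun_prop) fun y => ?_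
  exact (pow_pos (radialCutoff_den_pos hd (by positivity)) 2).ne'

lemma radialCutoff_nonneg {d p : ℝ} (hd : 0 < d) (hp : 0 ≤ p) : 0 ≤ radialCutoff d p :=
  div_nonneg hp (radialCutoff_den_pos hd hp).le

lemma radialCutoff_le_one {d p : ℝ} (hd : 0 < d) (hp : 0 ≤ p) : radialCutoff d p ≤ 1 := by
  unfold radialCutoff
  rw [div_le_one (radialCutoff_den_pos hd hp)]
  have : 0 ≤ d * p ^ 2 := by positivity
  linarith

lemma radialCutoff_le_div {d p : ℝ} (hd : 0 < d) (hp : 0 ≤ p) : radialCutoff d p ≤ p / d := by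
  unfold radialCutoff
  gcongr
  have : 0 ≤ d * p ^ 2 := by positivity
  linarith

lemma mul_radialCutoff_sq_le {d : ℝ} (hd : 0 < d) (r : ℝ) :
    r * radialCutoff d (r ^ 2) ≤ 1 / d := by
  unfold radialCutoff
  have h0 := radialCutoff_den_pos hd (sq_nonneg r)
  rw [← mul_div_assoc, div_le_div_iff₀ h0 hd]
  have h1 : r * r ^ 2 ≤ 1 + (r ^ 2) ^ 2 := by
    nlinarith [sq_nonneg (r ^ 2 - r), sq_nonneg (r ^ 2 - 1)]
  nlinarith [sq_nonneg r]

lemma mul_abs_radialCutoffDeriv_le {d p : ℝ} (hd : 0 < d) (hp : 0 ≤ p) :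
    p * |radialCutoffDeriv d p| ≤ 1 := by
  unfold radialCutoffDeriv
  have h0 := radialCutoff_den_pos hd hp
  rw [abs_div, abs_of_pos (pow_pos h0 2), ← mul_div_assoc, div_le_one (pow_pos h0 2), abs_mul,
    abs_of_pos hd]
  have h1 : |1 - p ^ 2| ≤ 1 + p ^ 2 := by
    rw [abs_le]; constructor <;> nlinarith [sq_nonneg p]
  have h2 : p * (d * |1 - p ^ 2|) ≤ p * (d * (1 + p ^ 2)) := by gcongr
  refine h2.trans ?_
  have h3 : 0 ≤ d * (1 + p ^ 2) := by positivity
  nlinarith [mul_nonneg hp h3, sq_nonneg p, sq_nonneg (d * (1 + p ^ 2))]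

lemma tendsto_radialCutoff {p : ℝ} (hp : 0 < p) :
    Tendsto (fun d => radialCutoff d p) (𝓝[>] 0) (𝓝 1) := by
  have : ContinuousAt (fun d : ℝ => p / (d + p + d * p ^ 2)) 0 := by
    refine ContinuousAt.div (by fun_prop) (by fun_prop) ?_
    simpa using hp.ne'
  have h := this.tendsto
  simp only [zero_add, zero_mul, add_zero, div_self hp.ne'] at h
  exact h.mono_left nhdsWithin_le_nhds

lemma tendsto_radialCutoffDeriv {p : ℝ} (hp : 0 < p) :
    Tendsto (fun d => radialCutoffDeriv d p) (𝓝[>] 0) (𝓝 0) := by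
  have : ContinuousAt (fun d : ℝ => d * (1 - p ^ 2) / (d + p + d * p ^ 2) ^ 2) 0 := by
    refine ContinuousAt.div (by fun_prop) (by fun_prop) ?_
    simpa using hp.ne'
  have h := this.tendsto
  simp only [zero_mul, zero_div] at h
  exact h.mono_left nhdsWithin_le_nhds

section IntegrationByParts

variable {E : Type*} [NormedAddCommGroup E] [InnerProductSpace ℝ E]

lemma hasLineDerivAt_norm_sq (y v : E) :
    HasLineDerivAt ℝ (fun y : E => ‖y‖ ^ 2) (2 * ⟪y, v⟫) y v := by
  have h := (hasStrictFDerivAt_norm_sq y).hasFDerivAt.hasLineDerivAt v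
  simpa using h

lemma hasLineDerivAt_radialCutoff {d : ℝ} (hd : 0 < d) (y v : E) :
    HasLineDerivAt ℝ (fun y : E => radialCutoff d (‖y‖ ^ 2))
      (radialCutoffDeriv d (‖y‖ ^ 2) * (2 * ⟪y, v⟫)) y v := by
  have h := hasLineDerivAt_norm_sq y v
  unfold HasLineDerivAt at h ⊢
  have h2 := hasDerivAt_radialCutoff hd (p := ‖y + (0 : ℝ) • v‖ ^ 2) (by positivity)
  have := h2.comp (0 : ℝ) h
  simpa [Function.comp_def] using this

lemma hasLineDerivAt_zero_of_abs_le_sq {k : E → ℝ} {M : ℝ} (hk : ∀ y, |k y| ≤ M * ‖y‖ ^ 2)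
    (v : E) : HasLineDerivAt ℝ k 0 0 v := by
  have h0 : k 0 = 0 := by simpa using hk 0
  have : HasFDerivAt k (0 : E →L[ℝ] ℝ) 0 := by
    rw [hasFDerivAt_iff_isLittleO_nhds_zero]
    simp only [zero_add, h0, sub_zero, _root_.zero_apply]
    have hO : (fun h : E => k h) =O[𝓝 0] fun h => ‖h‖ ^ 2 :=
      Asymptotics.IsBigO.of_bound M (Eventually.of_forall fun y => by simpa using hk y)
    refine hO.trans_isLittleO ?_
    simpa using (Asymptotics.isLittleO_norm_pow_id (E' := E) one_lt_two)
  simpa using this.hasLineDerivAt v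

variable [FiniteDimensional ℝ E] [MeasurableSpace E] [BorelSpace E]
  (μ : Measure E) [μ.IsAddHaarMeasure]

/-- Integration by parts when one of the factors is bounded and has a singularity at the origin. -/
lemma integral_mul_hasLineDerivAt_of_singular [Nontrivial E] {v : E} {φ φ' h h' : E → ℝ} {M : ℝ}
    (hφ : ∀ y, HasLineDerivAt ℝ φ (φ' y) y v)
    (hh : ∀ y, y ≠ 0 → HasLineDerivAt ℝ h (h' y) y v) (hM : ∀ y, |h y| ≤ M)
    (i1 : Integrable (fun y => φ' y * h y) μ) (i2 : Integrable (fun y => φ y * h' y) μ)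
    (i3 : Integrable (fun y => φ y * h y / ‖y‖) μ) :
    ∫ y, φ y * h' y ∂μ = - ∫ y, φ' y * h y ∂μ := by
  have hne : ∀ᵐ y ∂μ, y ≠ 0 := by simp [ae_iff]
  set A : ℝ → E → ℝ := fun d y => ‖y‖ * (radialCutoffDeriv d (‖y‖ ^ 2) * (2 * ⟪y, v⟫)) with hA
  have hAc : ∀ d, 0 < d → Continuous (A d) := fun d hd => by
    have := continuous_radialCutoffDeriv_normSq (E := E) hd
    fun_prop
  have hAb : ∀ d, 0 < d → ∀ y, ‖A d y‖ ≤ 2 * ‖v‖ := fun d hd y => by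
    have h1 := mul_abs_radialCutoffDeriv_le hd (sq_nonneg ‖y‖)
    have h2 := abs_real_inner_le_norm y v
    have : ‖A d y‖ = ‖y‖ * (|radialCutoffDeriv d (‖y‖ ^ 2)| * (2 * |⟪y, v⟫|)) := by
      simp [hA]
    rw [this]
    calc _ ≤ ‖y‖ * (|radialCutoffDeriv d (‖y‖ ^ 2)| * (2 * (‖y‖ * ‖v‖))) := by gcongr
      _ = (‖y‖ ^ 2 * |radialCutoffDeriv d (‖y‖ ^ 2)|) * (2 * ‖v‖) := by ring
      _ ≤ 1 * (2 * ‖v‖) := by gcongr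
      _ = _ := one_mul _
  have hA0 : ∀ y, y ≠ 0 → Tendsto (fun d => A d y) (𝓝[>] 0) (𝓝 0) := fun y hy => by
    have := ((tendsto_radialCutoffDeriv (p := ‖y‖ ^ 2) (by positivity)).mul_const
      (2 * ⟪y, v⟫)).const_mul ‖y‖
    simpa [hA] using this
  have hχb : ∀ d, 0 < d → ∀ y : E, ‖radialCutoff d (‖y‖ ^ 2)‖ ≤ 1 := fun d hd y => by
    rw [Real.norm_of_nonneg (radialCutoff_nonneg hd (by positivity))]
    exact radialCutoff_le_one hd (by positivity)
  have hχc : ∀ d, 0 < d → Continuous fun y : E => radialCutoff d (‖y‖ ^ 2) :=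
    fun d hd => continuous_radialCutoff_normSq hd
  have hd0 : ∀ᶠ d : ℝ in 𝓝[>] 0, 0 < d := self_mem_nhdsWithin
  -- the three truncated integrals are integrable
  have j1 : ∀ d, 0 < d → Integrable (fun y => radialCutoff d (‖y‖ ^ 2) * (φ' y * h y)) μ :=
    fun d hd => i1.bdd_mul (c := 1) (hχc d hd).aestronglyMeasurable
      (Eventually.of_forall (hχb d hd))
  have j2 : ∀ d, 0 < d → Integrable (fun y => radialCutoff d (‖y‖ ^ 2) * (φ y * h' y)) μ :=
    fun d hd => i2.bdd_mul (c := 1) (hχc d hd).aestronglyMeasurable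
      (Eventually.of_forall (hχb d hd))
  have j3 : ∀ d, 0 < d → Integrable (fun y => A d y * (φ y * h y / ‖y‖)) μ :=
    fun d hd => i3.bdd_mul (c := 2 * ‖v‖) (hAc d hd).aestronglyMeasurable
      (Eventually.of_forall (hAb d hd))
  have j4 : ∀ d, 0 < d →
      Integrable (fun y => (‖y‖ * radialCutoff d (‖y‖ ^ 2)) * (φ y * h y / ‖y‖)) μ :=
    fun d hd => i3.bdd_mul (c := 1 / d) (by have := hχc d hd; fun_prop)
      (Eventually.of_forall fun y => by
        rw [Real.norm_of_nonneg (mul_nonneg (norm_nonneg _)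
          (radialCutoff_nonneg hd (by positivity)))]
        exact mul_radialCutoff_sq_le hd ‖y‖)
  -- integration by parts for the truncated functions
  have key : ∀ d, 0 < d →
      (∫ y, A d y * (φ y * h y / ‖y‖) ∂μ) + ∫ y, radialCutoff d (‖y‖ ^ 2) * (φ y * h' y) ∂μ
        = - ∫ y, radialCutoff d (‖y‖ ^ 2) * (φ' y * h y) ∂μ := fun d hd => by
    set k : E → ℝ := fun y => radialCutoff d (‖y‖ ^ 2) * h y with hk
    set k' : E → ℝ := fun y => radialCutoffDeriv d (‖y‖ ^ 2) * (2 * ⟪y, v⟫) * h y +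
      radialCutoff d (‖y‖ ^ 2) * h' y with hk'
    have hkd : ∀ y, HasLineDerivAt ℝ k (k' y) y v := fun y => by
      by_cases hy : y = 0
      · subst hy
        have : k' 0 = 0 := by simp [hk', radialCutoff]
        rw [this]
        refine hasLineDerivAt_zero_of_abs_le_sq (M := M / d) (fun y => ?_) v
        have h1 := radialCutoff_le_div hd (sq_nonneg ‖y‖)
        have h2 := radialCutoff_nonneg hd (sq_nonneg ‖y‖)
        rw [hk, abs_mul, abs_of_nonneg h2]
        calc _ ≤ ‖y‖ ^ 2 / d * M := mul_le_mul h1 (hM y) (abs_nonneg _) (by positivity)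
          _ = _ := by ring
      · have h1 := hasLineDerivAt_radialCutoff hd y v
        have h2 := hh y hy
        unfold HasLineDerivAt at h1 h2 ⊢
        simpa [hk, hk'] using h1.fun_mul h2
    have e1 : ∀ y, φ y * k' y =
        A d y * (φ y * h y / ‖y‖) + radialCutoff d (‖y‖ ^ 2) * (φ y * h' y) := fun y => by
      by_cases hy : y = 0
      · simp [hy, hk', hA, radialCutoff]
      · have : ‖y‖ ≠ 0 := by simpa using hy
        simp only [hk', hA]
        field_simp
    have e2 : ∀ y, φ' y * k y = radialCutoff d (‖y‖ ^ 2) * (φ' y * h y) := fun y => by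
      simp only [hk]; ring
    have e3 : ∀ y, φ y * k y = (‖y‖ * radialCutoff d (‖y‖ ^ 2)) * (φ y * h y / ‖y‖) := fun y => by
      by_cases hy : y = 0
      · simp [hy, hk, radialCutoff]
      · have : ‖y‖ ≠ 0 := by simpa using hy
        simp only [hk]
        field_simp
    have := integral_bilinear_hasLineDerivAt_right_eq_neg_left_of_integrable (μ := μ)
      (f := φ) (f' := φ') (g := k) (g' := k') (v := v) (B := ContinuousLinearMap.mul ℝ ℝ)
      (by simpa only [ContinuousLinearMap.mul_apply', e2] using j1 d hd)
      (by simpa only [ContinuousLinearMap.mul_apply', e1] using (j3 d hd).fun_add (j2 d hd))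
      (by simpa only [ContinuousLinearMap.mul_apply', e3] using j4 d hd)
      (fun y _ => hφ y) (fun y _ => hkd y)
    simp only [ContinuousLinearMap.mul_apply', e1, e2] at this
    rwa [integral_add (j3 d hd) (j2 d hd)] at this
  -- passage to the limit
  have t3 : Tendsto (fun d => ∫ y, A d y * (φ y * h y / ‖y‖) ∂μ) (𝓝[>] 0) (𝓝 0) := by
    have := tendsto_integral_filter_of_dominated_convergence (μ := μ) (l := 𝓝[>] (0 : ℝ))
      (F := fun d y => A d y * (φ y * h y / ‖y‖)) (f := fun _ => 0)
      (fun y => 2 * ‖v‖ * ‖φ y * h y / ‖y‖‖)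
      (by filter_upwards [hd0] with d hd using (j3 d hd).aestronglyMeasurable)
      (by
        filter_upwards [hd0] with d hd
        filter_upwards with y
        rw [norm_mul]
        gcongr
        exact hAb d hd y)
      (i3.norm.const_mul _)
      (by
        filter_upwards [hne] with y hy
        simpa using (hA0 y hy).mul_const (φ y * h y / ‖y‖))
    simpa using this
  have tχ : ∀ G : E → ℝ, Integrable G μ →
      Tendsto (fun d => ∫ y, radialCutoff d (‖y‖ ^ 2) * G y ∂μ) (𝓝[>] 0) (𝓝 (∫ y, G y ∂μ)) := by
    intro G hG
    refine tendsto_integral_filter_of_dominated_convergence (fun y => ‖G y‖) ?_ ?_ hG.norm ?_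
    · filter_upwards [hd0] with d hd using
        (hG.bdd_mul (c := 1) (hχc d hd).aestronglyMeasurable
          (Eventually.of_forall (hχb d hd))).aestronglyMeasurable
    · filter_upwards [hd0] with d hd
      filter_upwards with y
      rw [norm_mul]
      exact mul_le_of_le_one_left (norm_nonneg _) (hχb d hd y)
    · filter_upwards [hne] with y hy
      simpa using (tendsto_radialCutoff (p := ‖y‖ ^ 2) (by positivity)).mul_const (G y)
  have L := t3.add (tχ _ i2)
  have R := (tχ _ i1).neg
  rw [zero_add] at L
  refine tendsto_nhds_unique (L.congr' ?_) R
  filter_upwards [hd0] with d hd using key d hd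

end IntegrationByParts

section Kernel

variable {E : Type*} [NormedAddCommGroup E]

/-- The regularized Euclidean norm `√(‖z‖ ^ 2 + ε ^ 2)`. -/
noncomputable def regNorm (ε : ℝ) (z : E) : ℝ := √(‖z‖ ^ 2 + ε ^ 2)

lemma regNorm_sq (ε : ℝ) (z : E) : regNorm ε z ^ 2 = ‖z‖ ^ 2 + ε ^ 2 :=
  Real.sq_sqrt (by positivity)

lemma regNorm_zero (z : E) : regNorm 0 z = ‖z‖ := by
  simp [regNorm]

lemma norm_le_regNorm (ε : ℝ) (z : E) : ‖z‖ ≤ regNorm ε z :=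
  Real.le_sqrt_of_sq_le (by nlinarith [sq_nonneg ε])

lemma le_regNorm (ε : ℝ) (z : E) : ε ≤ regNorm ε z :=
  Real.le_sqrt_of_sq_le (by nlinarith [sq_nonneg ‖z‖])

lemma regNorm_pos {ε : ℝ} (hε : 0 < ε) (z : E) : 0 < regNorm ε z :=
  hε.trans_le (le_regNorm ε z)

lemma continuous_regNorm (ε : ℝ) : Continuous (regNorm ε : E → ℝ) := by
  unfold regNorm
  fun_prop

lemma continuous_regNorm_left (z : E) : Continuous fun ε => regNorm ε z := by
  unfold regNorm
  fun_prop

lemma one_add_norm_le_regNorm {ε : ℝ} (hε : 0 < ε) (x y : E) :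
    1 + ‖y‖ ≤ ((1 + ‖x‖) / ε + 1) * regNorm ε (y - x) := by
  have h1 : ‖y‖ ≤ ‖y - x‖ + ‖x‖ := by simpa using norm_add_le (y - x) x
  have h2 := norm_le_regNorm ε (y - x)
  have h3 : 1 + ‖x‖ ≤ (1 + ‖x‖) / ε * regNorm ε (y - x) := by
    rw [div_mul_eq_mul_div, le_div_iff₀ hε]
    gcongr
    exact le_regNorm ε _
  linarith

lemma exists_inv_regNorm_pow_le {ε : ℝ} (hε : 0 < ε) (x : E) (k : ℕ) :
    ∃ A : ℝ, 0 ≤ A ∧ ∀ y : E, (regNorm ε (y - x) ^ k)⁻¹ ≤ A * ((1 + ‖y‖) ^ k)⁻¹ := by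
  refine ⟨((1 + ‖x‖) / ε + 1) ^ k, by positivity, fun y => ?_⟩
  have hR := regNorm_pos hε (y - x)
  rw [← div_eq_mul_inv, le_div_iff₀ (by positivity), inv_mul_le_iff₀ (by positivity), mul_comm,
    ← mul_pow]
  gcongr
  exact one_add_norm_le_regNorm hε x y

variable [InnerProductSpace ℝ E]

lemma hasLineDerivAt_inv_regNorm_pow {ε : ℝ} (hε : 0 < ε) (k : ℕ) (x y v : E) :
    HasLineDerivAt ℝ (fun y => (regNorm ε (y - x) ^ k)⁻¹)
      (-(k * ⟪v, y - x⟫ / regNorm ε (y - x) ^ (k + 2))) y v := by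
  have hR := regNorm_pos hε (y - x)
  have h0 : HasLineDerivAt ℝ (fun y => ‖y - x‖ ^ 2 + ε ^ 2) (2 * ⟪v, y - x⟫) y v := by
    have h := hasLineDerivAt_norm_sq (y - x) v
    unfold HasLineDerivAt at h ⊢
    rw [real_inner_comm]
    refine (h.add_const (ε ^ 2)).congr_of_eventuallyEq (Eventually.of_forall fun t => ?_)
    simp only
    congr 3
    abel
  unfold HasLineDerivAt at h0 ⊢
  have hs : HasDerivAt (fun t : ℝ => regNorm ε (y + t • v - x))
      (⟪v, y - x⟫ / regNorm ε (y - x)) 0 := by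
    have := h0.sqrt (by simp; positivity)
    refine this.congr_deriv ?_
    simp only [zero_smul, add_zero]
    rw [← regNorm, mul_div_mul_left _ _ two_ne_zero]
  have hp := (hs.fun_pow k).fun_inv (by simpa using (pow_pos hR k).ne')
  refine hp.congr_deriv ?_
  simp only [zero_smul, add_zero]
  rcases k with _ | k
  · simp
  · simp only [Nat.add_sub_cancel]
    field_simp
    ring

/-- The second derivative, in the directions `a` and `b`, of the regularized fundamental solution
of the Laplacian with pole at `x`, up to the factor `ω_n`. -/
noncomputable def hessKernel (n : ℕ) (ε : ℝ) (x a b y : E) : ℝ :=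
  ⟪a, b⟫ * (regNorm ε (y - x) ^ (n + 1))⁻¹ -
    (n + 1) * (⟪a, y - x⟫ * ⟪b, y - x⟫) * (regNorm ε (y - x) ^ (n + 3))⁻¹

/-- The third derivative of the regularized fundamental solution, up to the factor `ω_n`. -/
noncomputable def thirdKernel (n : ℕ) (ε : ℝ) (x a b c y : E) : ℝ :=
  -((n + 1) * (⟪a, b⟫ * ⟪c, y - x⟫ + ⟪a, c⟫ * ⟪b, y - x⟫ + ⟪b, c⟫ * ⟪a, y - x⟫) *
      (regNorm ε (y - x) ^ (n + 3))⁻¹) +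
    (n + 1) * (n + 3) * (⟪a, y - x⟫ * ⟪b, y - x⟫ * ⟪c, y - x⟫) * (regNorm ε (y - x) ^ (n + 5))⁻¹

lemma hessKernel_comm (n : ℕ) (ε : ℝ) (x a b y : E) :
    hessKernel n ε x a b y = hessKernel n ε x b a y := by
  unfold hessKernel
  rw [real_inner_comm a b]
  ring

lemma thirdKernel_comm_right (n : ℕ) (ε : ℝ) (x a b c y : E) :
    thirdKernel n ε x a b c y = thirdKernel n ε x a c b y := by
  unfold thirdKernel
  rw [real_inner_comm b c]
  ring

lemma hasLineDerivAt_hessKernel (n : ℕ) {ε : ℝ} (hε : 0 < ε) (x a b c y : E) :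
    HasLineDerivAt ℝ (hessKernel n ε x a b) (thirdKernel n ε x a b c y) y c := by
  have h1 := hasLineDerivAt_inv_regNorm_pow hε (n + 1) x y c
  have h3 := hasLineDerivAt_inv_regNorm_pow hε (n + 3) x y c
  have hl : ∀ e : E, HasDerivAt (fun t : ℝ => ⟪e, y + t • c - x⟫) ⟪e, c⟫ 0 := fun e => by
    have : ∀ t : ℝ, ⟪e, y + t • c - x⟫ = ⟪e, y - x⟫ + t * ⟪e, c⟫ := fun t => by
      rw [← real_inner_smul_right, ← inner_add_right]
      congr 1
      abel
    simp only [this]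
    simpa using ((hasDerivAt_id' (0 : ℝ)).mul_const ⟪e, c⟫).const_add ⟪e, y - x⟫
  unfold HasLineDerivAt at h1 h3 ⊢
  have := (h1.const_mul ⟪a, b⟫).fun_sub ((((hl a).fun_mul (hl b)).const_mul ((n : ℝ) + 1)).fun_mul h3)
  unfold hessKernel
  refine this.congr_deriv ?_
  unfold thirdKernel
  simp only [zero_smul, add_zero]
  push_cast
  have hR := (regNorm_pos hε (y - x)).ne'
  field_simp
  ring

lemma continuous_hessKernel (n : ℕ) {ε : ℝ} (hε : 0 < ε) (x a b : E) :
    Continuous (hessKernel n ε x a b) := by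
  have h := (continuous_regNorm (E := E) ε).comp (continuous_id.sub (continuous_const (y := x)))
  have hk : ∀ k : ℕ, Continuous fun y : E => (regNorm ε (y - x) ^ k)⁻¹ := fun k =>
    (h.pow k).inv₀ fun y => (pow_pos (regNorm_pos hε _) k).ne'
  have := hk (n + 1)
  have := hk (n + 3)
  unfold hessKernel
  fun_prop

lemma continuous_thirdKernel (n : ℕ) {ε : ℝ} (hε : 0 < ε) (x a b c : E) :
    Continuous (thirdKernel n ε x a b c) := by
  have h := (continuous_regNorm (E := E) ε).comp (continuous_id.sub (continuous_const (y := x)))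
  have hk : ∀ k : ℕ, Continuous fun y : E => (regNorm ε (y - x) ^ k)⁻¹ := fun k =>
    (h.pow k).inv₀ fun y => (pow_pos (regNorm_pos hε _) k).ne'
  have := hk (n + 3)
  have := hk (n + 5)
  unfold thirdKernel
  fun_prop

lemma abs_inner_le_regNorm {a : E} (ha : ‖a‖ = 1) (ε : ℝ) (z : E) : |⟪a, z⟫| ≤ regNorm ε z := by
  have := abs_real_inner_le_norm a z
  rw [ha, one_mul] at this
  exact this.trans (norm_le_regNorm ε z)

lemma abs_inner_le_one {a b : E} (ha : ‖a‖ = 1) (hb : ‖b‖ = 1) : |⟪a, b⟫| ≤ 1 := by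
  simpa [ha, hb] using abs_real_inner_le_norm a b

lemma abs_hessKernel_le (n : ℕ) (ε : ℝ) {x a b y : E} (hR : 0 < regNorm ε (y - x))
    (ha : ‖a‖ = 1) (hb : ‖b‖ = 1) :
    |hessKernel n ε x a b y| ≤ (n + 2) * (regNorm ε (y - x) ^ (n + 1))⁻¹ := by
  have h1 := abs_inner_le_one ha hb
  have h2 := abs_inner_le_regNorm ha ε (y - x)
  have h3 := abs_inner_le_regNorm hb ε (y - x)
  unfold hessKernel
  set R := regNorm ε (y - x)
  refine (abs_sub _ _).trans ?_
  rw [abs_mul, abs_mul, abs_mul, abs_mul, abs_of_pos (inv_pos.2 (pow_pos hR _)),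
    abs_of_pos (inv_pos.2 (pow_pos hR _)), abs_of_pos (by positivity : (0 : ℝ) < n + 1)]
  calc _ ≤ 1 * (R ^ (n + 1))⁻¹ + (n + 1) * (R * R) * (R ^ (n + 3))⁻¹ := by gcongr
    _ = _ := by field_simp; ring

lemma abs_thirdKernel_le (n : ℕ) (ε : ℝ) {x a b c y : E} (hR : 0 < regNorm ε (y - x))
    (ha : ‖a‖ = 1) (hb : ‖b‖ = 1) (hc : ‖c‖ = 1) :
    |thirdKernel n ε x a b c y| ≤
      (n + 1) * (n + 6) * (regNorm ε (y - x) ^ (n + 2))⁻¹ := by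
  have h1 := abs_inner_le_one ha hb
  have h1' := abs_inner_le_one ha hc
  have h1'' := abs_inner_le_one hb hc
  have h2 := abs_inner_le_regNorm ha ε (y - x)
  have h3 := abs_inner_le_regNorm hb ε (y - x)
  have h4 := abs_inner_le_regNorm hc ε (y - x)
  unfold thirdKernel
  set R := regNorm ε (y - x)
  have hs : |⟪a, b⟫ * ⟪c, y - x⟫ + ⟪a, c⟫ * ⟪b, y - x⟫ + ⟪b, c⟫ * ⟪a, y - x⟫| ≤
      1 * R + 1 * R + 1 * R := by
    refine (abs_add_three _ _ _).trans ?_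
    simp only [abs_mul]
    gcongr
  refine (abs_add_le _ _).trans ?_
  rw [abs_neg, abs_mul, abs_mul, abs_mul (((n : ℝ) + 1) * (n + 3) * _), abs_mul (((n : ℝ) + 1) * _),
    abs_of_pos (inv_pos.2 (pow_pos hR _)),
    abs_of_pos (inv_pos.2 (pow_pos hR _)), abs_of_pos (by positivity : (0 : ℝ) < n + 1),
    abs_of_pos (by positivity : (0 : ℝ) < (n + 1) * (n + 3)), abs_mul, abs_mul]
  calc _ ≤ (n + 1) * (1 * R + 1 * R + 1 * R) * (R ^ (n + 3))⁻¹ +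
      (n + 1) * (n + 3) * (R * R * R) * (R ^ (n + 5))⁻¹ := by gcongr
    _ = _ := by field_simp; ring

/-- The trace of `hessKernel` is the associated approximate identity. -/
lemma sum_hessKernel {ι : Type*} [Fintype ι] (e : OrthonormalBasis ι ℝ E) {n : ℕ}
    (hn : Fintype.card ι = n + 1) {ε : ℝ} (hε : 0 < ε) (x y : E) :
    ∑ i, hessKernel n ε x (e i) (e i) y = (n + 1) * ε ^ 2 * (regNorm ε (y - x) ^ (n + 3))⁻¹ := by
  unfold hessKernel
  have h1 : ∑ i, ⟪e i, y - x⟫ * ⟪e i, y - x⟫ = ‖y - x‖ ^ 2 := by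
    rw [← e.sum_sq_norm_inner_right (y - x)]
    refine Finset.sum_congr rfl fun i _ => ?_
    rw [Real.norm_eq_abs, sq_abs, sq]
  have h2 : ∑ i, ⟪e i, e i⟫ = (n : ℝ) + 1 := by
    simp [hn]
  rw [Finset.sum_sub_distrib, ← Finset.sum_mul, ← Finset.sum_mul, ← Finset.mul_sum, h1, h2]
  have hR := regNorm_pos hε (y - x)
  have hsq := regNorm_sq ε (y - x)
  set R := regNorm ε (y - x)
  have : ‖y - x‖ ^ 2 = R ^ 2 - ε ^ 2 := by linarith
  rw [this]
  field_simp
  ring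

end Kernel

section Integrability

variable {E : Type*} [NormedAddCommGroup E] [NormedSpace ℝ E] [FiniteDimensional ℝ E]
  [MeasurableSpace E] [BorelSpace E] (μ : Measure E) [μ.IsAddHaarMeasure]

lemma integrable_inv_norm_mul_inv_one_add_norm_pow {n : ℕ} (hn : 1 ≤ n)
    (hE : finrank ℝ E = n + 1) :
    Integrable (fun y : E => ‖y‖⁻¹ * ((1 + ‖y‖) ^ (n + 1))⁻¹) μ := by
  have : Nontrivial E := Module.nontrivial_of_finrank_pos (R := ℝ) (by omega)
  rw [integrable_fun_norm_addHaar μ (f := fun r : ℝ => r⁻¹ * ((1 + r) ^ (n + 1))⁻¹), hE,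
    Nat.add_sub_cancel]
  refine Integrable.mono' (g := fun r : ℝ => (1 + r ^ 2)⁻¹)
    integrable_inv_one_add_sq.integrableOn ?_ ?_
  · refine ContinuousOn.aestronglyMeasurable (fun r (hr : 0 < r) => ?_) measurableSet_Ioi
    have h1 : (1 + r) ^ (n + 1) ≠ 0 := by positivity
    have h2 : r ≠ 0 := hr.ne'
    apply ContinuousAt.continuousWithinAt
    fun_prop (disch := assumption)
  · refine (ae_restrict_iff' measurableSet_Ioi).2 (Eventually.of_forall fun r (hr : 0 < r) => ?_)
    rw [Real.norm_of_nonneg (by positivity)]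
    obtain ⟨k, rfl⟩ := Nat.exists_eq_add_of_le' hn
    have h1 : r ^ (k + 1) • (r⁻¹ * ((1 + r) ^ (k + 1 + 1))⁻¹) = r ^ k * ((1 + r) ^ (k + 2))⁻¹ := by
      rw [smul_eq_mul]
      field_simp
      ring
    rw [h1]
    calc r ^ k * ((1 + r) ^ (k + 2))⁻¹ ≤ (1 + r) ^ k * ((1 + r) ^ (k + 2))⁻¹ := by
          gcongr
          linarith
      _ = ((1 + r) ^ 2)⁻¹ := by field_simp; ring
      _ ≤ _ := by
          gcongr
          nlinarith

lemma integrable_inv_one_add_norm_pow {n : ℕ} (hn : 1 ≤ n) (hE : finrank ℝ E = n + 1) :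
    Integrable (fun y : E => ((1 + ‖y‖) ^ (n + 2))⁻¹) μ := by
  have : Nontrivial E := Module.nontrivial_of_finrank_pos (R := ℝ) (by omega)
  have hne : ∀ᵐ y ∂μ, y ≠ 0 := by simp [ae_iff]
  refine (integrable_inv_norm_mul_inv_one_add_norm_pow μ hn hE).mono' ?_ ?_
  · exact Continuous.aestronglyMeasurable
      (Continuous.inv₀ (by fun_prop) fun y => by positivity)
  · filter_upwards [hne] with y hy
    have : 0 < ‖y‖ := norm_pos_iff.2 hy
    rw [Real.norm_of_nonneg (by positivity), ← mul_inv, pow_succ' _ (n + 1)]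
    gcongr
    linarith

lemma integrable_indicator_ball_rpow {n : ℕ} (hE : finrank ℝ E = n + 1) {α : ℝ} (hα : 0 < α)
    (x : E) {r : ℝ} (hr : 0 < r) :
    Integrable ((ball x r).indicator fun y => ‖y - x‖ ^ α * (‖y - x‖ ^ (n + 1))⁻¹) μ := by
  have : Nontrivial E := Module.nontrivial_of_finrank_pos (R := ℝ) (by omega)
  have h : IntegrableOn (fun y : E => ‖y‖ ^ α * (‖y‖ ^ (n + 1))⁻¹) (ball 0 r) μ := by
    rw [integrableOn_fun_norm_addHaar μ (f := fun t : ℝ => t ^ α * (t ^ (n + 1))⁻¹), hE,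
      Nat.add_sub_cancel]
    have : IntegrableOn (fun t : ℝ => t ^ (α - 1)) (Ioo 0 r) :=
      (intervalIntegral.integrableOn_Ioo_rpow_iff hr).2 (by linarith)
    refine this.congr_fun (fun t ht => ?_) measurableSet_Ioo
    have ht0 : 0 < t := ht.1
    simp only [smul_eq_mul]
    rw [Real.rpow_sub_one ht0.ne']
    field_simp
    ring
  have h2 := ((integrable_indicator_iff measurableSet_ball).2 h).comp_sub_right x
  refine h2.congr (Eventually.of_forall fun y => ?_)
  by_cases hy : ‖y - x‖ < r <;> simp [indicator, dist_eq_norm, hy]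

end Integrability

section ApproximateIdentity

lemma integral_Ioi_pow_mul_inv_sqrt_pow (n : ℕ) :
    ∫ r in Ioi (0 : ℝ), r ^ n * ((n + 1) * (√(r ^ 2 + 1) ^ (n + 3))⁻¹) = 1 := by
  have hR : ∀ r : ℝ, 0 < √(r ^ 2 + 1) := fun r => Real.sqrt_pos.2 (by positivity)
  have hd : ∀ r : ℝ, HasDerivAt (fun r : ℝ => (r / √(r ^ 2 + 1)) ^ (n + 1))
      (r ^ n * ((n + 1) * (√(r ^ 2 + 1) ^ (n + 3))⁻¹)) r := fun r => by
    have h1 : HasDerivAt (fun r : ℝ => r ^ 2 + 1) (2 * r) r := by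
      simpa using (hasDerivAt_pow 2 r).add_const 1
    have h2 := h1.sqrt (by positivity)
    have h3 := ((hasDerivAt_id' r).fun_div h2 (hR r).ne').fun_pow (n + 1)
    refine h3.congr_deriv ?_
    have hsq : √(r ^ 2 + 1) ^ 2 = r ^ 2 + 1 := Real.sq_sqrt (by positivity)
    have h0 := (hR r).ne'
    set R := √(r ^ 2 + 1)
    simp only [Nat.add_sub_cancel, Nat.cast_add, Nat.cast_one]
    have h4 : (1 * R - r * (2 * r / (2 * R))) / R ^ 2 = (R ^ 3)⁻¹ := by
      field_simp
      linarith
    rw [h4, div_pow]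
    field_simp
    ring
  have ht : Tendsto (fun r : ℝ => (r / √(r ^ 2 + 1)) ^ (n + 1)) atTop (𝓝 1) := by
    have h1 : Tendsto (fun r : ℝ => √(1 - (r ^ 2 + 1)⁻¹)) atTop (𝓝 1) := by
      have : Tendsto (fun r : ℝ => (r ^ 2 + 1)⁻¹) atTop (𝓝 0) :=
        (tendsto_atTop_add_const_right _ _ (tendsto_pow_atTop two_ne_zero)).inv_tendsto_atTop
      simpa using (this.const_sub 1).sqrt
    have h2 : Tendsto (fun r : ℝ => r / √(r ^ 2 + 1)) atTop (𝓝 1) := by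
      refine h1.congr' ?_
      filter_upwards [eventually_ge_atTop 0] with r hr
      have : 1 - (r ^ 2 + 1)⁻¹ = r ^ 2 / (r ^ 2 + 1) := by field_simp; ring
      rw [this, Real.sqrt_div (by positivity), Real.sqrt_sq hr]
    simpa using h2.pow (n + 1)
  have := integral_Ioi_of_hasDerivAt_of_nonneg' (a := 0) (fun r _ => hd r)
    (fun r (hr : 0 < r) => by have := hR r; positivity) ht
  simpa using this

variable {E : Type*} [NormedAddCommGroup E]

lemma regNorm_one_inv_smul [NormedSpace ℝ E] {ε : ℝ} (hε : 0 < ε) (z : E) :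
    regNorm 1 (ε⁻¹ • z) = ε⁻¹ * regNorm ε z := by
  unfold regNorm
  have : ‖ε⁻¹ • z‖ ^ 2 + 1 ^ 2 = ε⁻¹ ^ 2 * (‖z‖ ^ 2 + ε ^ 2) := by
    rw [norm_smul, Real.norm_of_nonneg (by positivity)]
    field_simp
  rw [this, Real.sqrt_mul (by positivity), Real.sqrt_sq (by positivity)]

lemma inv_norm_sub_pow_le {x y : E} (hx : ‖x‖ = 1) (hy : 1 / 2 ≤ ‖y - x‖) (k : ℕ) :
    (‖y - x‖ ^ k)⁻¹ ≤ 5 ^ k * ((1 + ‖y‖) ^ k)⁻¹ := by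
  have h1 : ‖y‖ ≤ ‖y - x‖ + ‖x‖ := by simpa using norm_add_le (y - x) x
  rw [← div_eq_mul_inv, le_div_iff₀ (by positivity), inv_mul_le_iff₀ (by positivity), mul_comm,
    ← mul_pow]
  gcongr
  linarith

variable [NormedSpace ℝ E] [FiniteDimensional ℝ E]
  [MeasurableSpace E] [BorelSpace E] (μ : Measure E) [μ.IsAddHaarMeasure]

lemma integral_inv_regNorm_pow {n : ℕ} (hE : finrank ℝ E = n + 1) :
    ∫ z : E, (n + 1) * (regNorm 1 z ^ (n + 3))⁻¹ ∂μ = (n + 1) * μ.real (ball 0 1) := by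
  have : Nontrivial E := Module.nontrivial_of_finrank_pos (R := ℝ) (by omega)
  have h := integral_fun_norm_addHaar μ
    (fun r : ℝ => (n + 1) * (√(r ^ 2 + 1) ^ (n + 3))⁻¹)
  simp only [hE, Nat.add_sub_cancel, smul_eq_mul, integral_Ioi_pow_mul_inv_sqrt_pow] at h
  simpa [regNorm] using h

lemma tendsto_integral_regNorm_pow_mul {n : ℕ} (hn : 1 ≤ n) (hE : finrank ℝ E = n + 1)
    {q : E → ℝ} {M : ℝ} (hq : Measurable q) (hM : ∀ y, |q y| ≤ M * ‖y‖⁻¹) {x : E}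
    (hx : ‖x‖ = 1) (hqx : ContinuousAt q x) :
    Tendsto (fun ε => ∫ y, (n + 1) * ε ^ 2 * (regNorm ε (y - x) ^ (n + 3))⁻¹ * q y ∂μ) (𝓝[>] 0)
      (𝓝 ((n + 1) * μ.real (ball (0 : E) 1) * q x)) := by
  have : Nontrivial E := Module.nontrivial_of_finrank_pos (R := ℝ) (by omega)
  have hM0 : 0 ≤ M := by simpa [hx] using (abs_nonneg _).trans (hM x)
  set ω : ℝ := (n + 1) * μ.real (ball (0 : E) 1) with hω
  have hω0 : 0 < ω := by
    have : 0 < μ.real (ball (0 : E) 1) :=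
      ENNReal.toReal_pos (measure_ball_pos μ _ one_pos).ne' measure_ball_lt_top.ne
    positivity
  have hpos : ∀ᶠ ε : ℝ in 𝓝[>] 0, 0 < ε := self_mem_nhdsWithin
  have hker : ∀ ε : ℝ, 0 < ε → Continuous fun y : E => (regNorm ε (y - x) ^ (n + 3))⁻¹ :=
    fun ε hε => (((continuous_regNorm (E := E) ε).comp
      (continuous_id.sub (continuous_const (y := x)))).pow _).inv₀
      fun y => (pow_pos (regNorm_pos hε _) _).ne'
  set B := ball x (1 / 2) with hB
  have hBm : MeasurableSet B := measurableSet_ball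
  have hgi : Integrable (B.indicator q) μ := by
    rw [integrable_indicator_iff hBm]
    refine Measure.integrableOn_of_bounded (M := M * 2) measure_ball_lt_top.ne
      hq.aestronglyMeasurable ?_
    refine (ae_restrict_iff' hBm).2 (Eventually.of_forall fun y hy => ?_)
    refine (hM y).trans ?_
    gcongr
    rw [hB, mem_ball, dist_eq_norm] at hy
    have h1 : ‖x‖ ≤ ‖y - x‖ + ‖y‖ := by
      have := norm_sub_le y (y - x)
      rw [sub_sub_cancel] at this
      linarith
    exact inv_le_of_inv_le₀ (by norm_num) (by linarith)
  -- the part near `x`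
  have hnear : Tendsto (fun ε => ∫ y, (n + 1) * ε ^ 2 * (regNorm ε (y - x) ^ (n + 3))⁻¹ *
      B.indicator q y ∂μ) (𝓝[>] 0) (𝓝 (ω * q x)) := by
    have hgc : ContinuousAt (B.indicator q) x := by
      refine hqx.congr ?_
      filter_upwards [ball_mem_nhds x (by norm_num : (0 : ℝ) < 1 / 2)] with y hy
      rw [indicator_of_mem hy]
    have hgx : B.indicator q x = q x :=
      indicator_of_mem (mem_ball_self (by norm_num)) q
    have hpk := tendsto_integral_comp_smul_smul_of_integrable' (μ := μ)
      (φ := fun z : E => ω⁻¹ * ((n + 1) * (regNorm 1 z ^ (n + 3))⁻¹))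
      (fun z => by have := regNorm_pos one_pos z; positivity)
      (by rw [integral_const_mul, integral_inv_regNorm_pow μ hE, inv_mul_cancel₀ hω0.ne'])
      (by
        rw [hE]
        have h1 : Tendsto (fun z : E => ω⁻¹ * (n + 1) * (‖z‖ ^ 2)⁻¹) (Bornology.cobounded E)
            (𝓝 0) := by
          have := ((tendsto_pow_atTop two_ne_zero).comp
            (tendsto_norm_cobounded_atTop (E := E))).inv_tendsto_atTop.const_mul (ω⁻¹ * (n + 1))
          simpa using this
        refine squeeze_zero' (Eventually.of_forall fun z => ?_) ?_ h1
        · have := regNorm_pos one_pos z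
          positivity
        · filter_upwards [Bornology.eventually_ne_cobounded 0] with z hz
          have hz : 0 < ‖z‖ := norm_pos_iff.2 hz
          calc _ ≤ ‖z‖ ^ (n + 1) * (ω⁻¹ * ((n + 1) * (‖z‖ ^ (n + 3))⁻¹)) := by
                gcongr
                exact norm_le_regNorm 1 z
            _ = _ := by field_simp; ring)
      hgi hgc
    have h2 := (hpk.comp tendsto_inv_nhdsGT_zero).const_mul ω
    rw [hgx] at h2
    refine h2.congr' ?_
    filter_upwards [hpos] with ε hε
    simp only [Function.comp_apply]
    rw [← integral_const_mul]
    refine integral_congr_ae (Eventually.of_forall fun y => ?_)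
    have hR := regNorm_pos hε (y - x)
    simp only [smul_eq_mul]
    rw [regNorm_one_inv_smul hε, hE]
    have hsymm : regNorm ε (x - y) = regNorm ε (y - x) := by
      unfold regNorm
      rw [norm_sub_rev]
    rw [hsymm, mul_pow, inv_pow, inv_pow]
    field_simp
    ring
  -- the part away from `x`
  have hdom := (integrable_inv_norm_mul_inv_one_add_norm_pow μ hn hE).const_mul
    ((n + 1) * 5 ^ (n + 3) * M)
  have hle : ∀ᶠ ε : ℝ in 𝓝[>] 0, ε < 1 := nhdsWithin_le_nhds (Iio_mem_nhds one_pos)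
  have hfm : ∀ ε : ℝ, 0 < ε → AEStronglyMeasurable
      (fun y => (n + 1) * ε ^ 2 * (regNorm ε (y - x) ^ (n + 3))⁻¹ * Bᶜ.indicator q y) μ :=
    fun ε hε => (((hker ε hε).measurable.const_mul _).mul
      (hq.indicator hBm.compl)).aestronglyMeasurable
  have hfb : ∀ ε : ℝ, 0 < ε → ε < 1 → ∀ y,
      ‖(n + 1) * ε ^ 2 * (regNorm ε (y - x) ^ (n + 3))⁻¹ * Bᶜ.indicator q y‖ ≤
        (n + 1) * 5 ^ (n + 3) * M * (‖y‖⁻¹ * ((1 + ‖y‖) ^ (n + 1))⁻¹) := fun ε hε hε1 y => by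
    by_cases hy : y ∈ B
    · rw [indicator_of_notMem (by simpa using hy), mul_zero, norm_zero]
      positivity
    · rw [indicator_of_mem (by simpa using hy), norm_mul]
      have hR := regNorm_pos hε (y - x)
      rw [Real.norm_of_nonneg (by positivity)]
      have hy2 : 1 / 2 ≤ ‖y - x‖ := by simpa [hB, dist_eq_norm] using hy
      have hy0 : 0 < ‖y - x‖ := by linarith
      calc _ ≤ (n + 1) * 1 ^ 2 * (‖y - x‖ ^ (n + 3))⁻¹ * (M * ‖y‖⁻¹) := by
            gcongr
            · exact norm_le_regNorm ε _
            · exact hM y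
        _ ≤ (n + 1) * 1 ^ 2 * (5 ^ (n + 3) * ((1 + ‖y‖) ^ (n + 3))⁻¹) * (M * ‖y‖⁻¹) := by
            gcongr
            exact inv_norm_sub_pow_le hx hy2 _
        _ ≤ (n + 1) * 1 ^ 2 * (5 ^ (n + 3) * ((1 + ‖y‖) ^ (n + 1))⁻¹) * (M * ‖y‖⁻¹) := by
            gcongr ?_ * (_ * ?_⁻¹) * _
            exact pow_le_pow_right₀ (by linarith [norm_nonneg y]) (by omega)
        _ = _ := by ring
  have hfar : Tendsto (fun ε => ∫ y, (n + 1) * ε ^ 2 * (regNorm ε (y - x) ^ (n + 3))⁻¹ *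
      Bᶜ.indicator q y ∂μ) (𝓝[>] 0) (𝓝 0) := by
    have := tendsto_integral_filter_of_dominated_convergence (μ := μ) (l := 𝓝[>] (0 : ℝ))
      (F := fun ε y => (n + 1) * ε ^ 2 * (regNorm ε (y - x) ^ (n + 3))⁻¹ * Bᶜ.indicator q y)
      (f := fun _ => 0) _ ?_ ?_ hdom ?_
    · simpa using this
    · filter_upwards [hpos] with ε hε using hfm ε hε
    · filter_upwards [hpos, hle] with ε hε hε1
      filter_upwards with y using hfb ε hε hε1 y
    · filter_upwards with y
      by_cases hy : y ∈ B
      · simp [indicator_of_notMem (show y ∉ Bᶜ by simpa using hy)]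
      · have hy2 : 1 / 2 ≤ ‖y - x‖ := by simpa [hB, dist_eq_norm] using hy
        have hc : ContinuousAt (fun ε => (n + 1) * ε ^ 2 * (regNorm ε (y - x) ^ (n + 3))⁻¹ *
            Bᶜ.indicator q y) 0 := by
          have h1 : ContinuousAt (fun ε => (regNorm ε (y - x) ^ (n + 3))⁻¹) 0 := by
            refine ((continuous_regNorm_left (y - x)).pow _).continuousAt.inv₀ ?_
            rw [Pi.pow_apply, regNorm_zero]
            have : 0 < ‖y - x‖ := by linarith
            positivity
          fun_prop
        simpa using hc.tendsto.mono_left nhdsWithin_le_nhds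
  have hsum := hnear.add hfar
  rw [add_zero] at hsum
  refine hsum.congr' ?_
  filter_upwards [hpos, hle] with ε hε hε1
  have i1 : Integrable (fun y => (n + 1) * ε ^ 2 * (regNorm ε (y - x) ^ (n + 3))⁻¹ *
      B.indicator q y) μ := by
    refine hgi.bdd_mul (c := (n + 1) * ε ^ 2 * (ε ^ (n + 3))⁻¹)
      ((hker ε hε).measurable.const_mul _).aestronglyMeasurable (Eventually.of_forall fun y => ?_)
    have hR := regNorm_pos hε (y - x)
    rw [Real.norm_of_nonneg (by positivity)]
    gcongr
    exact le_regNorm ε _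
  have i2 := hdom.mono' (hfm ε hε) (Eventually.of_forall (hfb ε hε hε1))
  rw [← integral_add i1 i2]
  refine integral_congr_ae (Eventually.of_forall fun y => ?_)
  simp only
  rw [← mul_add, ← Pi.add_apply, indicator_self_add_compl]

end ApproximateIdentity

section Homogeneous

variable {E : Type*} [NormedAddCommGroup E] [InnerProductSpace ℝ E] {w : E → ℝ}

lemma fderiv_smul_of_homogeneous (hw : ∀ t : ℝ, 0 < t → ∀ y, w (t • y) = t * w y) {t : ℝ}
    (ht : 0 < t) (y : E) : fderiv ℝ w (t • y) = fderiv ℝ w y := by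
  have h1 : (fun y => w (t • y)) = t • w := funext fun y => hw t ht y
  have h2 := fderiv_comp_smul (𝕜 := ℝ) (f := w) (x := y) t
  rw [h1, fderiv_const_smul_field] at h2
  exact (smul_right_injective _ ht.ne' h2).symm

lemma smul_fderiv_fderiv_smul_of_homogeneous
    (hw : ∀ t : ℝ, 0 < t → ∀ y, w (t • y) = t * w y) {t : ℝ} (ht : 0 < t) (y : E) :
    t • fderiv ℝ (fderiv ℝ w) (t • y) = fderiv ℝ (fderiv ℝ w) y := by
  rw [← fderiv_comp_smul]
  congr 1
  exact funext fun y => fderiv_smul_of_homogeneous hw ht y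

lemma fderiv_fderiv_zero_of_homogeneous (hw : ∀ t : ℝ, 0 < t → ∀ y, w (t • y) = t * w y) :
    fderiv ℝ (fderiv ℝ w) 0 = 0 := by
  have h := smul_fderiv_fderiv_smul_of_homogeneous hw two_pos 0
  rw [smul_zero, two_smul] at h
  simpa using h

lemma contDiffAt_of_contDiffOn_compl_zero (hC : ContDiffOn ℝ 2 w {0}ᶜ) {y : E} (hy : y ≠ 0) :
    ContDiffAt ℝ 2 w y :=
  hC.contDiffAt (isOpen_compl_singleton.mem_nhds hy)

lemma contDiffAt_fderiv_of_contDiffOn_compl_zero (hC : ContDiffOn ℝ 2 w {0}ᶜ) {y : E}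
    (hy : y ≠ 0) : ContDiffAt ℝ 1 (fderiv ℝ w) y :=
  (contDiffAt_of_contDiffOn_compl_zero hC hy).fderiv_right (by norm_num)

lemma hasFDerivAt_fderiv_of_contDiffOn_compl_zero (hC : ContDiffOn ℝ 2 w {0}ᶜ) {y : E}
    (hy : y ≠ 0) : HasFDerivAt (fderiv ℝ w) (fderiv ℝ (fderiv ℝ w) y) y :=
  ((contDiffAt_fderiv_of_contDiffOn_compl_zero hC hy).differentiableAt one_ne_zero).hasFDerivAt

lemma continuousAt_fderiv_fderiv_of_contDiffOn_compl_zero (hC : ContDiffOn ℝ 2 w {0}ᶜ) {y : E}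
    (hy : y ≠ 0) : ContinuousAt (fderiv ℝ (fderiv ℝ w)) y :=
  ((contDiffAt_fderiv_of_contDiffOn_compl_zero hC hy).fderiv_right (m := 0)
    (by norm_num)).continuousAt

lemma fderiv_fderiv_comm_of_homogeneous (hw : ∀ t : ℝ, 0 < t → ∀ y, w (t • y) = t * w y)
    (hC : ContDiffOn ℝ 2 w {0}ᶜ) (y a b : E) :
    fderiv ℝ (fderiv ℝ w) y a b = fderiv ℝ (fderiv ℝ w) y b a := by
  by_cases hy : y = 0
  · simp [hy, fderiv_fderiv_zero_of_homogeneous hw]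
  · exact ((contDiffAt_of_contDiffOn_compl_zero hC hy).isSymmSndFDerivAt (by simp)).eq a b

/-- Euler's relation for the gradient of a function which is homogeneous of degree one. -/
lemma fderiv_fderiv_self_of_homogeneous (hw : ∀ t : ℝ, 0 < t → ∀ y, w (t • y) = t * w y)
    (hC : ContDiffOn ℝ 2 w {0}ᶜ) {y : E} (hy : y ≠ 0) :
    fderiv ℝ (fderiv ℝ w) y y = 0 := by
  have h1 : HasDerivAt (fun t : ℝ => fderiv ℝ w (t • y)) (fderiv ℝ (fderiv ℝ w) y y) 1 := by
    have hf : HasFDerivAt (fderiv ℝ w) (fderiv ℝ (fderiv ℝ w) y) ((1 : ℝ) • y) := by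
      simpa using hasFDerivAt_fderiv_of_contDiffOn_compl_zero hC hy
    have hg : HasDerivAt (fun t : ℝ => t • y) y 1 := by
      simpa using (hasDerivAt_id' (1 : ℝ)).smul_const y
    exact hf.comp_hasDerivAt (1 : ℝ) hg
  have h2 : HasDerivAt (fun t : ℝ => fderiv ℝ w (t • y)) 0 1 := by
    refine (hasDerivAt_const (1 : ℝ) (fderiv ℝ w y)).congr_of_eventuallyEq ?_
    filter_upwards [eventually_gt_nhds one_pos] with t ht
    exact fderiv_smul_of_homogeneous hw ht y
  exact h1.unique h2

variable [FiniteDimensional ℝ E]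

lemma exists_norm_fderiv_le_of_homogeneous (hw : ∀ t : ℝ, 0 < t → ∀ y, w (t • y) = t * w y)
    (hC : ContDiffOn ℝ 2 w {0}ᶜ) : ∃ M, ∀ y, ‖fderiv ℝ w y‖ ≤ M := by
  have hc : ContinuousOn (fderiv ℝ w) (sphere 0 1) := fun y hy =>
    (contDiffAt_fderiv_of_contDiffOn_compl_zero hC
      (ne_zero_of_mem_unit_sphere ⟨y, hy⟩)).continuousAt.continuousWithinAt
  obtain ⟨M, hM⟩ := (isCompact_sphere (0 : E) 1).exists_bound_of_continuousOn hc
  refine ⟨max M ‖fderiv ℝ w 0‖, fun y => ?_⟩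
  by_cases hy : y = 0
  · rw [hy]
    exact le_max_right _ _
  · have hy' : 0 < ‖y‖ := norm_pos_iff.2 hy
    rw [← fderiv_smul_of_homogeneous hw (inv_pos.2 hy')]
    exact (hM _ (by simp [norm_smul, hy'.ne'])).trans (le_max_left _ _)

lemma exists_abs_fderiv_fderiv_apply_le_of_homogeneous
    (hw : ∀ t : ℝ, 0 < t → ∀ y, w (t • y) = t * w y) (hC : ContDiffOn ℝ 2 w {0}ᶜ) :
    ∃ M, ∀ y a b, ‖a‖ = 1 → ‖b‖ = 1 →
      |fderiv ℝ (fderiv ℝ w) y a b| ≤ M * ‖y‖⁻¹ := by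
  have hc : ContinuousOn (fun y => ‖fderiv ℝ (fderiv ℝ w) y‖) (sphere 0 1) := fun y hy => by
    have h := continuousAt_fderiv_fderiv_of_contDiffOn_compl_zero hC
      (ne_zero_of_mem_unit_sphere ⟨y, hy⟩)
    exact (ContinuousAt.norm (E := E →L[ℝ] E →L[ℝ] ℝ) h).continuousWithinAt
  obtain ⟨M, hM⟩ := (isCompact_sphere (0 : E) 1).exists_bound_of_continuousOn hc
  refine ⟨M, fun y a b ha hb => ?_⟩
  by_cases hy : y = 0
  · simp [hy, fderiv_fderiv_zero_of_homogeneous hw]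
  · have hy' : 0 < ‖y‖ := norm_pos_iff.2 hy
    have h := (fderiv ℝ (fderiv ℝ w) (‖y‖⁻¹ • y)).le_opNorm₂ a b
    rw [ha, hb, mul_one, mul_one] at h
    rw [← smul_fderiv_fderiv_smul_of_homogeneous hw (inv_pos.2 hy'), smul_apply,
      smul_apply, smul_eq_mul, abs_mul, abs_inv, abs_norm, mul_comm]
    gcongr
    exact h.trans ((Real.le_norm_self _).trans (hM _ (by simp [norm_smul, hy'.ne'])))

variable [MeasurableSpace E] [BorelSpace E]

omit [FiniteDimensional ℝ E] in
lemma measurable_fderiv_fderiv_apply (w : E → ℝ) (a b : E) :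
    Measurable fun y => fderiv ℝ (fderiv ℝ w) y a b :=
  (ContinuousLinearMap.measurable_apply b).comp (measurable_fderiv_apply_const ℝ (fderiv ℝ w) a)

variable (μ : Measure E) [μ.IsAddHaarMeasure]

lemma integrable_hessKernel_mul {n : ℕ} (hn : 1 ≤ n) (hE : finrank ℝ E = n + 1) {ε : ℝ}
    (hε : 0 < ε) (x : E) {a b : E} (ha : ‖a‖ = 1) (hb : ‖b‖ = 1) {q : E → ℝ} {M : ℝ}
    (hq : AEStronglyMeasurable q μ) (hM : ∀ y, |q y| ≤ M * ‖y‖⁻¹) :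
    Integrable (fun y => hessKernel n ε x a b y * q y) μ := by
  obtain ⟨A, hA0, hA⟩ := exists_inv_regNorm_pow_le hε x (n + 1)
  refine ((integrable_inv_norm_mul_inv_one_add_norm_pow μ hn hE).const_mul
    ((n + 2) * A * M)).mono' ((continuous_hessKernel n hε x a b).aestronglyMeasurable.mul hq)
    (Eventually.of_forall fun y => ?_)
  rw [norm_mul, Real.norm_eq_abs, Real.norm_eq_abs]
  have hR := regNorm_pos hε (y - x)
  calc _ ≤ (n + 2) * (regNorm ε (y - x) ^ (n + 1))⁻¹ * (M * ‖y‖⁻¹) := by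
        gcongr
        · exact abs_hessKernel_le n ε hR ha hb
        · exact hM y
    _ ≤ (n + 2) * (A * ((1 + ‖y‖) ^ (n + 1))⁻¹) * (M * ‖y‖⁻¹) := by
        have := (abs_nonneg _).trans (hM y)
        gcongr
        exact hA y
    _ = _ := by ring

lemma integrable_thirdKernel_mul {n : ℕ} (hn : 1 ≤ n) (hE : finrank ℝ E = n + 1) {ε : ℝ}
    (hε : 0 < ε) (x : E) {a b c : E} (ha : ‖a‖ = 1) (hb : ‖b‖ = 1) (hc : ‖c‖ = 1) {h : E → ℝ}
    {M : ℝ} (hh : AEStronglyMeasurable h μ) (hM : ∀ y, |h y| ≤ M) :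
    Integrable (fun y => thirdKernel n ε x a b c y * h y) μ := by
  obtain ⟨A, hA0, hA⟩ := exists_inv_regNorm_pow_le hε x (n + 2)
  refine ((integrable_inv_one_add_norm_pow μ hn hE).const_mul
    ((n + 1) * (n + 6) * A * M)).mono'
    ((continuous_thirdKernel n hε x a b c).aestronglyMeasurable.mul hh)
    (Eventually.of_forall fun y => ?_)
  rw [norm_mul, Real.norm_eq_abs, Real.norm_eq_abs]
  have hR := regNorm_pos hε (y - x)
  calc _ ≤ (n + 1) * (n + 6) * (regNorm ε (y - x) ^ (n + 2))⁻¹ * M := by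
        gcongr
        · exact abs_thirdKernel_le n ε hR ha hb hc
        · exact hM y
    _ ≤ (n + 1) * (n + 6) * (A * ((1 + ‖y‖) ^ (n + 2))⁻¹) * M := by
        have := (abs_nonneg _).trans (hM y)
        gcongr
        exact hA y
    _ = _ := by ring

lemma integral_hessKernel_mul_fderiv_fderiv (hw : ∀ t : ℝ, 0 < t → ∀ y, w (t • y) = t * w y)
    (hC : ContDiffOn ℝ 2 w {0}ᶜ) {n : ℕ} (hn : 1 ≤ n) (hE : finrank ℝ E = n + 1) {ε : ℝ}
    (hε : 0 < ε) (x : E) {a b c d : E} (ha : ‖a‖ = 1) (hb : ‖b‖ = 1) (hc : ‖c‖ = 1)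
    (hd : ‖d‖ = 1) :
    ∫ y, hessKernel n ε x a b y * fderiv ℝ (fderiv ℝ w) y c d ∂μ =
      - ∫ y, thirdKernel n ε x a b c y * fderiv ℝ w y d ∂μ := by
  have : Nontrivial E := Module.nontrivial_of_finrank_pos (R := ℝ) (by omega)
  obtain ⟨M, hM⟩ := exists_norm_fderiv_le_of_homogeneous hw hC
  obtain ⟨M', hM'⟩ := exists_abs_fderiv_fderiv_apply_le_of_homogeneous hw hC
  have hb1 : ∀ y, |fderiv ℝ w y d| ≤ M := fun y => by
    have := (fderiv ℝ w y).le_opNorm d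
    rw [hd, mul_one] at this
    exact this.trans (hM y)
  have hm1 : Measurable fun y => fderiv ℝ w y d := measurable_fderiv_apply_const ℝ w d
  refine integral_mul_hasLineDerivAt_of_singular μ (M := M)
    (fun y => hasLineDerivAt_hessKernel n hε x a b c y) (fun y hy => ?_) hb1
    (integrable_thirdKernel_mul μ hn hE hε x ha hb hc hm1.aestronglyMeasurable hb1)
    (integrable_hessKernel_mul μ hn hE hε x ha hb
      (measurable_fderiv_fderiv_apply w c d).aestronglyMeasurable
      fun y => hM' y c d hc hd) ?_
  · have h := hasFDerivAt_fderiv_of_contDiffOn_compl_zero hC hy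
    have := ((ContinuousLinearMap.apply ℝ ℝ d).hasFDerivAt.comp y h).hasLineDerivAt c
    simpa [Function.comp_def] using this
  · have := integrable_hessKernel_mul μ hn hE hε x ha hb (M := M)
      (q := fun y => fderiv ℝ w y d * ‖y‖⁻¹)
      (hm1.mul measurable_norm.inv).aestronglyMeasurable fun y => by
        rw [abs_mul, abs_inv, abs_norm]
        gcongr
        exact hb1 y
    simpa [div_eq_mul_inv, mul_assoc] using this

/-- Two pairs of derivatives may be exchanged between the regularized kernel and `w`. -/
lemma integral_hessKernel_swap (hw : ∀ t : ℝ, 0 < t → ∀ y, w (t • y) = t * w y)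
    (hC : ContDiffOn ℝ 2 w {0}ᶜ) {n : ℕ} (hn : 1 ≤ n) (hE : finrank ℝ E = n + 1) {ε : ℝ}
    (hε : 0 < ε) (x : E) {a b : E} (ha : ‖a‖ = 1) (hb : ‖b‖ = 1) :
    ∫ y, hessKernel n ε x a a y * fderiv ℝ (fderiv ℝ w) y b b ∂μ =
      ∫ y, hessKernel n ε x b b y * fderiv ℝ (fderiv ℝ w) y a a ∂μ := by
  have h1 := integral_hessKernel_mul_fderiv_fderiv μ hw hC hn hE hε x ha ha hb hb
  have h2 := integral_hessKernel_mul_fderiv_fderiv μ hw hC hn hE hε x ha hb ha hb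
  have h3 := integral_hessKernel_mul_fderiv_fderiv μ hw hC hn hE hε x hb ha hb ha
  have h4 := integral_hessKernel_mul_fderiv_fderiv μ hw hC hn hE hε x hb hb ha ha
  simp only [thirdKernel_comm_right n ε x a a b] at h1
  simp only [thirdKernel_comm_right n ε x b b a] at h4
  rw [h1, ← h2, h4, ← h3]
  refine integral_congr_ae (Eventually.of_forall fun y => ?_)
  simp only
  rw [hessKernel_comm, fderiv_fderiv_comm_of_homogeneous hw hC]

lemma integral_hessKernel_mul_laplacian {ι : Type*} [Fintype ι] (e : OrthonormalBasis ι ℝ E)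
    (hw : ∀ t : ℝ, 0 < t → ∀ y, w (t • y) = t * w y)
    (hC : ContDiffOn ℝ 2 w {0}ᶜ) {n : ℕ} (hn : 1 ≤ n) (hE : finrank ℝ E = n + 1) {ε : ℝ}
    (hε : 0 < ε) (x : E) {a : E} (ha : ‖a‖ = 1) :
    ∫ y, hessKernel n ε x a a y * ∑ i, fderiv ℝ (fderiv ℝ w) y (e i) (e i) ∂μ =
      ∫ y, (n + 1) * ε ^ 2 * (regNorm ε (y - x) ^ (n + 3))⁻¹ *
        fderiv ℝ (fderiv ℝ w) y a a ∂μ := by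
  have hcard : Fintype.card ι = n + 1 := by rw [← hE, finrank_eq_card_basis e.toBasis]
  obtain ⟨M, hM⟩ := exists_abs_fderiv_fderiv_apply_le_of_homogeneous hw hC
  have hi : ∀ a b : E, ‖a‖ = 1 → ‖b‖ = 1 →
      Integrable (fun y => hessKernel n ε x a a y * fderiv ℝ (fderiv ℝ w) y b b) μ :=
    fun a b ha hb => integrable_hessKernel_mul μ hn hE hε x ha ha
      (measurable_fderiv_fderiv_apply w b b).aestronglyMeasurable
      fun y => hM y b b hb hb
  simp only [← sum_hessKernel e hcard hε x, Finset.mul_sum, Finset.sum_mul]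
  rw [integral_finsetSum _ fun i _ => hi a (e i) ha (e.norm_eq_one i),
    integral_finsetSum _ fun i _ => hi (e i) a (e.norm_eq_one i) ha]
  exact Finset.sum_congr rfl fun i _ =>
    integral_hessKernel_swap μ hw hC hn hE hε x ha (e.norm_eq_one i)

end Homogeneous

section SingularKernel

variable {E : Type*} [NormedAddCommGroup E] [InnerProductSpace ℝ E] [FiniteDimensional ℝ E]
  [MeasurableSpace E] [BorelSpace E] (μ : Measure E) [μ.IsAddHaarMeasure]

lemma exists_integrable_bound_hessKernel_mul {n : ℕ} (hn : 1 ≤ n) (hE : finrank ℝ E = n + 1)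
    {x a : E} (hx : ‖x‖ = 1) (ha : ‖a‖ = 1) {g : E → ℝ} {M C α : ℝ} (hα : 0 < α)
    (hM : ∀ y, |g y| ≤ M * ‖y‖⁻¹) (hg : ∀ y, |g y| ≤ C * ‖y - x‖ ^ α * ‖y‖⁻¹) :
    ∃ D : E → ℝ, Integrable D μ ∧
      ∀ ε y, y ≠ x → ‖hessKernel n ε x a a y * g y‖ ≤ D y := by
  have hM0 : 0 ≤ M := by simpa [hx] using (abs_nonneg _).trans (hM x)
  have hC0 : 0 ≤ C := by
    have h := (abs_nonneg _).trans (hg (-x))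
    have h2 : ‖-x - x‖ = 2 := by
      rw [← neg_add', ← two_smul ℝ x, norm_neg, norm_smul, hx]
      norm_num
    rw [h2, norm_neg, hx, inv_one, mul_one] at h
    exact nonneg_of_mul_nonneg_left h (by positivity)
  refine ⟨fun y => (n + 2) * (C * 2) * (ball x (1 / 2)).indicator
      (fun y => ‖y - x‖ ^ α * (‖y - x‖ ^ (n + 1))⁻¹) y +
      (n + 2) * 5 ^ (n + 1) * M * (‖y‖⁻¹ * ((1 + ‖y‖) ^ (n + 1))⁻¹),
    ((integrable_indicator_ball_rpow μ hE hα x (by norm_num)).const_mul _).add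
      ((integrable_inv_norm_mul_inv_one_add_norm_pow μ hn hE).const_mul _), fun ε y hy => ?_⟩
  have hz : 0 < ‖y - x‖ := norm_pos_iff.2 (sub_ne_zero.2 hy)
  have hR : 0 < regNorm ε (y - x) := hz.trans_le (norm_le_regNorm ε _)
  have hk : |hessKernel n ε x a a y| ≤ (n + 2) * (‖y - x‖ ^ (n + 1))⁻¹ := by
    refine (abs_hessKernel_le n ε hR ha ha).trans ?_
    gcongr
    exact norm_le_regNorm ε _
  rw [norm_mul, Real.norm_eq_abs, Real.norm_eq_abs]
  by_cases hyB : y ∈ ball x (1 / 2)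
  · beta_reduce
    rw [indicator_of_mem hyB]
    refine le_add_of_le_of_nonneg ?_ (by positivity)
    rw [mem_ball, dist_eq_norm] at hyB
    have h1 : ‖x‖ ≤ ‖y - x‖ + ‖y‖ := by
      have := norm_sub_le y (y - x)
      rw [sub_sub_cancel] at this
      linarith
    have h2 : ‖y‖⁻¹ ≤ 2 := inv_le_of_inv_le₀ (by norm_num) (by linarith)
    calc _ ≤ (n + 2) * (‖y - x‖ ^ (n + 1))⁻¹ * (C * ‖y - x‖ ^ α * 2) := by
          refine mul_le_mul hk ((hg y).trans ?_) (abs_nonneg _) (by positivity)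
          gcongr
      _ = _ := by ring
  · beta_reduce
    rw [indicator_of_notMem hyB, mul_zero, zero_add]
    have hy2 : 1 / 2 ≤ ‖y - x‖ := by simpa [dist_eq_norm] using hyB
    calc _ ≤ (n + 2) * (5 ^ (n + 1) * ((1 + ‖y‖) ^ (n + 1))⁻¹) * (M * ‖y‖⁻¹) := by
          refine mul_le_mul (hk.trans ?_) (hM y) (abs_nonneg _) (by positivity)
          gcongr
          exact inv_norm_sub_pow_le hx hy2 _
      _ = _ := by ring

omit [FiniteDimensional ℝ E] [MeasurableSpace E] [BorelSpace E] in
lemma tendsto_hessKernel (n : ℕ) (a b : E) {x y : E} (hy : y ≠ x) :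
    Tendsto (fun ε => hessKernel n ε x a b y) (𝓝[>] 0) (𝓝 (hessKernel n 0 x a b y)) := by
  have hz : 0 < ‖y - x‖ := norm_pos_iff.2 (sub_ne_zero.2 hy)
  have h1 : ∀ k : ℕ, ContinuousAt (fun ε => (regNorm ε (y - x) ^ k)⁻¹) 0 := fun k => by
    refine ((continuous_regNorm_left (y - x)).pow _).continuousAt.inv₀ ?_
    rw [Pi.pow_apply, regNorm_zero]
    positivity
  have h : ContinuousAt (fun ε => hessKernel n ε x a b y) 0 := by
    have := h1 (n + 1)
    have := h1 (n + 3)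
    unfold hessKernel
    fun_prop
  exact h.tendsto.mono_left nhdsWithin_le_nhds

lemma integrable_and_tendsto_hessKernel_mul {n : ℕ} (hn : 1 ≤ n) (hE : finrank ℝ E = n + 1)
    {x a : E} (hx : ‖x‖ = 1) (ha : ‖a‖ = 1) {g : E → ℝ} {M C α : ℝ} (hα : 0 < α)
    (hgm : AEStronglyMeasurable g μ)
    (hM : ∀ y, |g y| ≤ M * ‖y‖⁻¹) (hg : ∀ y, |g y| ≤ C * ‖y - x‖ ^ α * ‖y‖⁻¹) :
    Integrable (fun y => hessKernel n 0 x a a y * g y) μ ∧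
      Tendsto (fun ε => ∫ y, hessKernel n ε x a a y * g y ∂μ) (𝓝[>] 0)
        (𝓝 (∫ y, hessKernel n 0 x a a y * g y ∂μ)) := by
  have : Nontrivial E := Module.nontrivial_of_finrank_pos (R := ℝ) (by omega)
  obtain ⟨D, hD, hle⟩ := exists_integrable_bound_hessKernel_mul μ hn hE hx ha hα hM hg
  have hne : ∀ᵐ y ∂μ, y ≠ x := by simp [ae_iff]
  have hpos : ∀ᶠ ε : ℝ in 𝓝[>] 0, 0 < ε := self_mem_nhdsWithin
  have hm : ∀ ε, AEStronglyMeasurable (fun y => hessKernel n ε x a a y * g y) μ := fun ε => by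
    refine AEStronglyMeasurable.mul (Measurable.aestronglyMeasurable ?_) hgm
    have h := ((continuous_regNorm (E := E) ε).comp
      (continuous_id.sub (continuous_const (y := x)))).measurable
    have hk : ∀ k : ℕ, Measurable fun y : E => (regNorm ε (y - x) ^ k)⁻¹ := fun k =>
      (h.pow_const k).inv
    have := hk (n + 1)
    have := hk (n + 3)
    unfold hessKernel
    fun_prop
  refine ⟨hD.mono' (hm 0) (hne.mono fun y hy => hle 0 y hy),
    tendsto_integral_filter_of_dominated_convergence D (Eventually.of_forall hm)
      (Eventually.of_forall fun ε => hne.mono fun y hy => hle ε y hy) hD ?_⟩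
  filter_upwards [hne] with y hy
  exact (tendsto_hessKernel n a a hy).mul_const (g y)

/-- The second derivatives of a function homogeneous of degree one, as singular integrals of its
Laplacian, at a point where the Laplacian vanishes to positive order. -/
theorem integral_hessKernel_mul_eq {ι : Type*} [Fintype ι] (e : OrthonormalBasis ι ℝ E)
    {w : E → ℝ} (hw : ∀ t : ℝ, 0 < t → ∀ y, w (t • y) = t * w y)
    (hC : ContDiffOn ℝ 2 w {0}ᶜ) {n : ℕ} (hn : 1 ≤ n) (hE : finrank ℝ E = n + 1)
    {x a : E} (hx : ‖x‖ = 1) (ha : ‖a‖ = 1) {C α : ℝ} (hα : 0 < α)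
    (hg : ∀ y, y ≠ 0 →
      |∑ i, fderiv ℝ (fderiv ℝ w) y (e i) (e i)| ≤ C * ‖y - x‖ ^ α * ‖y‖⁻¹) :
    Integrable (fun y => hessKernel n 0 x a a y *
        ∑ i, fderiv ℝ (fderiv ℝ w) y (e i) (e i)) μ ∧
      ∫ y, hessKernel n 0 x a a y * ∑ i, fderiv ℝ (fderiv ℝ w) y (e i) (e i) ∂μ =
        (n + 1) * μ.real (ball (0 : E) 1) * fderiv ℝ (fderiv ℝ w) x a a := by
  obtain ⟨M, hM⟩ := exists_abs_fderiv_fderiv_apply_le_of_homogeneous hw hC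
  have hg' : ∀ y, |∑ i, fderiv ℝ (fderiv ℝ w) y (e i) (e i)| ≤ C * ‖y - x‖ ^ α * ‖y‖⁻¹ :=
    fun y => by
      by_cases hy : y = 0
      · simp [hy, fderiv_fderiv_zero_of_homogeneous hw]
      · exact hg y hy
  have hMs : ∀ y, |∑ i, fderiv ℝ (fderiv ℝ w) y (e i) (e i)| ≤
      (Fintype.card ι * M) * ‖y‖⁻¹ := fun y => by
    refine (Finset.abs_sum_le_sum_abs _ _).trans ((Finset.sum_le_sum fun i _ =>
      hM y (e i) (e i) (e.norm_eq_one i) (e.norm_eq_one i)).trans ?_)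
    simp [mul_assoc]
  have hx0 : x ≠ 0 := by
    rintro rfl
    simp at hx
  obtain ⟨h1, h2⟩ := integrable_and_tendsto_hessKernel_mul μ hn hE hx ha hα
    (Finset.measurable_fun_sum _ fun i _ =>
      measurable_fderiv_fderiv_apply w (e i) (e i)).aestronglyMeasurable hMs hg'
  refine ⟨h1, tendsto_nhds_unique h2 ?_⟩
  have hq : ContinuousAt (fun y => fderiv ℝ (fderiv ℝ w) y a a) x :=
    ((continuousAt_fderiv_fderiv_of_contDiffOn_compl_zero hC hx0).clm_apply
      continuousAt_const).clm_apply continuousAt_const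
  refine (tendsto_integral_regNorm_pow_mul μ hn hE (measurable_fderiv_fderiv_apply w a a)
    (fun y => hM y a a ha ha) hx hq).congr' ?_
  filter_upwards [self_mem_nhdsWithin] with ε hε
  exact (integral_hessKernel_mul_laplacian μ e hw hC hn hE hε x ha).symm

end SingularKernel

section NormHessian

variable {E : Type*} [NormedAddCommGroup E] [InnerProductSpace ℝ E]

lemma hasFDerivAt_norm_of_ne_zero {y : E} (hy : y ≠ 0) :
    HasFDerivAt (fun z : E => ‖z‖) (‖y‖⁻¹ • innerSL ℝ y) y := by
  have hy' : ‖y‖ ≠ 0 := norm_ne_zero_iff.2 hy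
  have h := (hasStrictFDerivAt_norm_sq y).hasFDerivAt.sqrt (pow_ne_zero 2 hy')
  simp only [Real.sqrt_sq (norm_nonneg _)] at h
  refine h.congr_fderiv ?_
  ext a
  simp
  field_simp

lemma fderiv_fderiv_norm {y : E} (hy : y ≠ 0) (a : E) :
    fderiv ℝ (fderiv ℝ fun z : E => ‖z‖) y a a =
      ‖y‖⁻¹ * ‖a‖ ^ 2 - (‖y‖ ^ 3)⁻¹ * ⟪y, a⟫ ^ 2 := by
  have hy' : ‖y‖ ≠ 0 := norm_ne_zero_iff.2 hy
  have h1 : (fderiv ℝ fun z : E => ‖z‖) =ᶠ[𝓝 y] fun z => ‖z‖⁻¹ • innerSL ℝ z := by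
    filter_upwards [isOpen_compl_singleton.mem_nhds hy] with z hz
    exact (hasFDerivAt_norm_of_ne_zero hz).fderiv
  have h2 : HasFDerivAt (fun z : E => ‖z‖⁻¹) (-(‖y‖ ^ 2)⁻¹ • ‖y‖⁻¹ • innerSL ℝ y) y :=
    (hasDerivAt_inv hy').comp_hasFDerivAt y (hasFDerivAt_norm_of_ne_zero hy)
  have h3 := h2.fun_smul (innerSL ℝ (E := E)).hasFDerivAt (x := y)
  rw [h1.fderiv_eq, h3.fderiv]
  change ‖y‖⁻¹ * ⟪a, a⟫ + (-(‖y‖ ^ 2)⁻¹ * (‖y‖⁻¹ * ⟪y, a⟫)) * ⟪y, a⟫ = _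
  rw [real_inner_self_eq_norm_sq]
  field_simp
  ring

lemma fderiv_fderiv_sub_smul_norm {u : E → ℝ} (hC : ContDiffOn ℝ 2 u {0}ᶜ) (c : ℝ) {y : E}
    (hy : y ≠ 0) (a : E) :
    fderiv ℝ (fderiv ℝ fun z => u z - c * ‖z‖) y a a = fderiv ℝ (fderiv ℝ u) y a a -
      c * (‖y‖⁻¹ * ‖a‖ ^ 2 - (‖y‖ ^ 3)⁻¹ * ⟪y, a⟫ ^ 2) := by
  have hN : ContDiffOn ℝ 2 (fun z : E => ‖z‖) {0}ᶜ := fun z hz =>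
    (contDiffAt_norm ℝ hz).contDiffWithinAt
  have h1 : (fderiv ℝ fun z => u z - c * ‖z‖) =ᶠ[𝓝 y]
      fun z => fderiv ℝ u z - c • fderiv ℝ (fun z : E => ‖z‖) z := by
    filter_upwards [isOpen_compl_singleton.mem_nhds hy] with z hz
    have hu := (contDiffAt_of_contDiffOn_compl_zero hC hz).differentiableAt two_ne_zero
    have hn := (contDiffAt_of_contDiffOn_compl_zero hN hz).differentiableAt two_ne_zero
    exact (hu.hasFDerivAt.sub (hn.hasFDerivAt.const_mul c)).fderiv
  rw [h1.fderiv_eq, ((hasFDerivAt_fderiv_of_contDiffOn_compl_zero hC hy).fun_sub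
    ((hasFDerivAt_fderiv_of_contDiffOn_compl_zero hN hy).fun_const_smul c)).fderiv,
    ← fderiv_fderiv_norm hy]
  simp

end NormHessian

section Convexity

variable {E : Type*} [NormedAddCommGroup E] [InnerProductSpace ℝ E] {u : E → ℝ}

lemma hasDerivAt_line_of_contDiffOn_compl_zero (hC : ContDiffOn ℝ 2 u {0}ᶜ) {a v : E} {t : ℝ}
    (h : a + t • v ≠ 0) :
    HasDerivAt (fun t : ℝ => u (a + t • v)) (fderiv ℝ u (a + t • v) v) t := by
  have hl : HasDerivAt (fun t : ℝ => a + t • v) v t := by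
    simpa using ((hasDerivAt_id' t).smul_const v).const_add a
  exact ((contDiffAt_of_contDiffOn_compl_zero hC h).differentiableAt
    two_ne_zero).hasFDerivAt.comp_hasDerivAt t hl

lemma hasDerivAt_fderiv_line_of_contDiffOn_compl_zero (hC : ContDiffOn ℝ 2 u {0}ᶜ) {a v : E}
    {t : ℝ} (h : a + t • v ≠ 0) :
    HasDerivAt (fun t : ℝ => fderiv ℝ u (a + t • v) v)
      (fderiv ℝ (fderiv ℝ u) (a + t • v) v v) t := by
  have hl : HasDerivAt (fun t : ℝ => a + t • v) v t := by
    simpa using ((hasDerivAt_id' t).smul_const v).const_add a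
  have h1 := (hasFDerivAt_fderiv_of_contDiffOn_compl_zero hC h).comp_hasDerivAt t hl
  exact ((ContinuousLinearMap.apply ℝ ℝ v).hasFDerivAt).comp_hasDerivAt t h1

lemma fderiv_fderiv_nonneg_of_convexOn (hC : ContDiffOn ℝ 2 u {0}ᶜ) (hu : ConvexOn ℝ univ u)
    {x v : E} (hx : ‖x‖ = 1) (hxv : ⟪v, x⟫ = 0) : 0 ≤ fderiv ℝ (fderiv ℝ u) x v v := by
  have hne : ∀ t : ℝ, x + t • v ≠ 0 := fun t h => by
    have := congrArg (fun z => ⟪z, x⟫) h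
    simp [inner_add_left, inner_smul_left, hxv, hx] at this
  have hconv : ConvexOn ℝ univ fun t : ℝ => u (x + t • v) := by
    have := hu.comp_affineMap (AffineMap.lineMap x (x + v) : ℝ →ᵃ[ℝ] E)
    simpa [Function.comp_def, AffineMap.lineMap_apply, add_comm] using this
  have hmono : Monotone fun t : ℝ => fderiv ℝ u (x + t • v) v := by
    have h := hconv.monotoneOn_deriv fun t _ =>
      (hasDerivAt_line_of_contDiffOn_compl_zero hC (hne t)).differentiableAt
    have h' : deriv (fun t : ℝ => u (x + t • v)) = fun t => fderiv ℝ u (x + t • v) v :=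
      funext fun t => (hasDerivAt_line_of_contDiffOn_compl_zero hC (hne t)).deriv
    rw [h'] at h
    exact monotoneOn_univ.1 h
  have h := hasDerivAt_fderiv_line_of_contDiffOn_compl_zero hC (hne 0)
  simpa using h.nonneg_of_monotone hmono

/-- Nonnegativity of the Hessian in tangential directions on the sphere propagates to all
directions and points. -/
lemma fderiv_fderiv_nonneg_of_tangential (hw : ∀ t : ℝ, 0 < t → ∀ y, u (t • y) = t * u y)
    (hC : ContDiffOn ℝ 2 u {0}ᶜ)
    (h : ∀ x ξ, ‖x‖ = 1 → ‖ξ‖ = 1 → ⟪ξ, x⟫ = 0 → 0 ≤ fderiv ℝ (fderiv ℝ u) x ξ ξ) (y v : E) :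
    0 ≤ fderiv ℝ (fderiv ℝ u) y v v := by
  by_cases hy : y = 0
  · simp [hy, fderiv_fderiv_zero_of_homogeneous hw]
  have hy' : 0 < ‖y‖ := norm_pos_iff.2 hy
  set x := ‖y‖⁻¹ • y with hxdef
  have hx : ‖x‖ = 1 := by simp [hxdef, norm_smul, hy'.ne']
  have hx0 : x ≠ 0 := by
    intro h0
    simp [h0] at hx
  rw [← smul_fderiv_fderiv_smul_of_homogeneous hw (inv_pos.2 hy') y, ← hxdef]
  refine mul_nonneg (inv_nonneg.2 hy'.le) ?_
  set ξ := v - ⟪x, v⟫ • x with hξdef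
  have hξ : ⟪ξ, x⟫ = 0 := by
    rw [hξdef, inner_sub_left, inner_smul_left, real_inner_self_eq_norm_sq, hx, real_inner_comm]
    simp
  have hv : v = ξ + ⟪x, v⟫ • x := by rw [hξdef, sub_add_cancel]
  have h1 : fderiv ℝ (fderiv ℝ u) x x = 0 := fderiv_fderiv_self_of_homogeneous hw hC hx0
  have h2 : fderiv ℝ (fderiv ℝ u) x ξ x = 0 := by
    rw [fderiv_fderiv_comm_of_homogeneous hw hC, h1]
    simp
  have h3 : fderiv ℝ (fderiv ℝ u) x v v = fderiv ℝ (fderiv ℝ u) x ξ ξ := by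
    generalize ⟪x, v⟫ = s at hv
    rw [hv]
    simp [h1, h2]
  change 0 ≤ fderiv ℝ (fderiv ℝ u) x v v
  rw [h3]
  by_cases hξ0 : ξ = 0
  · simp [hξ0]
  have hξ' : 0 < ‖ξ‖ := norm_pos_iff.2 hξ0
  have h4 := h x (‖ξ‖⁻¹ • ξ) hx (by simp [norm_smul, hξ'.ne']) (by simp [inner_smul_left, hξ])
  have h5 : fderiv ℝ (fderiv ℝ u) x ξ ξ =
      ‖ξ‖ ^ 2 * fderiv ℝ (fderiv ℝ u) x (‖ξ‖⁻¹ • ξ) (‖ξ‖⁻¹ • ξ) := by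
    simp
    field_simp
  rw [h5]
  positivity

lemma convexOn_of_fderiv_fderiv_nonneg (hE : 3 ≤ finrank ℝ E) (hu : Continuous u)
    (hC : ContDiffOn ℝ 2 u {0}ᶜ) (h : ∀ y v, 0 ≤ fderiv ℝ (fderiv ℝ u) y v v) :
    ConvexOn ℝ univ u := by
  refine ⟨convex_univ, fun a _ b _ s t hs ht hst => ?_⟩
  obtain ⟨v, hv⟩ : ∃ v, v ∉ Submodule.span ℝ ({a, b} : Set E) := by
    by_contra! hall
    classical
    have h1 : Submodule.span ℝ ({a, b} : Set E) = ⊤ := Submodule.eq_top_iff'.2 hall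
    have h2 := finrank_span_finset_le_card (R := ℝ) ({a, b} : Finset E)
    have h3 := Finset.card_le_two (a := a) (b := b)
    rw [Finset.coe_pair, Set.finrank, h1, finrank_top] at h2
    omega
  have hline : ∀ δ : ℝ, δ ≠ 0 →
      u (s • (a + δ • v) + t • (b + δ • v)) ≤ s * u (a + δ • v) + t * u (b + δ • v) := by
    intro δ hδ
    have hne : ∀ r : ℝ, (a + δ • v) + r • (b - a) ≠ 0 := fun r h0 => hv <| by
      have : v = δ⁻¹ • (-a - r • (b - a)) := by
        rw [eq_inv_smul_iff₀ hδ, ← sub_eq_zero, ← h0]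
        abel
      rw [this]
      have ha : a ∈ Submodule.span ℝ ({a, b} : Set E) := Submodule.subset_span (by simp)
      have hb : b ∈ Submodule.span ℝ ({a, b} : Set E) := Submodule.subset_span (by simp)
      exact Submodule.smul_mem _ _ (sub_mem (neg_mem ha) (Submodule.smul_mem _ _ (sub_mem hb ha)))
    have hconv : ConvexOn ℝ univ fun r : ℝ => u ((a + δ • v) + r • (b - a)) :=
      convexOn_of_hasDerivWithinAt2_nonneg convex_univ
        (fun r _ => (hasDerivAt_line_of_contDiffOn_compl_zero hC (hne
          r)).continuousAt.continuousWithinAt)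
        (fun r _ => (hasDerivAt_line_of_contDiffOn_compl_zero hC (hne r)).hasDerivWithinAt)
        (fun r _ => (hasDerivAt_fderiv_line_of_contDiffOn_compl_zero hC (hne r)).hasDerivWithinAt)
        (fun r _ => h _ _)
    have := hconv.2 (mem_univ 0) (mem_univ 1) hs ht hst
    obtain rfl : s = 1 - t := by linarith
    simp only [smul_eq_mul, mul_zero, mul_one, zero_add, zero_smul, add_zero, one_smul] at this
    have e1 : a + δ • v + (b - a) = b + δ • v := by abel
    have e2 : (1 - t) • (a + δ • v) + t • (b + δ • v) = a + δ • v + t • (b - a) := by module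
    rwa [e1, ← e2] at this
  have hcv : ∀ c : E, ContinuousAt (fun δ : ℝ => u (c + δ • v)) 0 := fun c => by fun_prop
  have hl : Tendsto (fun δ : ℝ => u (s • (a + δ • v) + t • (b + δ • v))) (𝓝[≠] 0)
      (𝓝 (u (s • a + t • b))) := by
    have : ContinuousAt (fun δ : ℝ => u (s • (a + δ • v) + t • (b + δ • v))) 0 := by fun_prop
    simpa [ContinuousAt] using this.tendsto.mono_left (nhdsWithin_le_nhds (s := {0}ᶜ))
  have hr : Tendsto (fun δ : ℝ => s * u (a + δ • v) + t * u (b + δ • v)) (𝓝[≠] 0)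
      (𝓝 (s * u a + t * u b)) := by
    have : ContinuousAt (fun δ : ℝ => s * u (a + δ • v) + t * u (b + δ • v)) 0 := by fun_prop
    simpa [ContinuousAt] using this.tendsto.mono_left (nhdsWithin_le_nhds (s := {0}ᶜ))
  refine le_of_tendsto_of_tendsto hl hr ?_
  filter_upwards [self_mem_nhdsWithin] with δ hδ
  exact hline δ hδ

end Convexity

section SingularIntegral

lemma omega_n_eq (n : ℕ) : omega_n n =
    (n + 1) * (volume : Measure (EuclideanSpace ℝ (Fin (n + 1)))).real (ball 0 1) := by
  rw [omega_n, Measure.toSphere_apply_univ, ENNReal.toReal_mul, finrank_euclideanSpace_fin,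
    ENNReal.toReal_natCast, Measure.real]
  push_cast
  rfl

lemma omega_n_pos (n : ℕ) : 0 < omega_n n := by
  rw [omega_n_eq]
  have : 0 < (volume : Measure (EuclideanSpace ℝ (Fin (n + 1)))).real (ball 0 1) :=
    ENNReal.toReal_pos (measure_ball_pos _ _ one_pos).ne' measure_ball_lt_top.ne
  positivity

lemma laplacian_eq_sum_fderiv_fderiv {m : ℕ} {u : EuclideanSpace ℝ (Fin m) → ℝ}
    (hC : ContDiffOn ℝ 2 u {0}ᶜ) {y : EuclideanSpace ℝ (Fin m)} (hy : y ≠ 0) :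
    laplacian u y = ∑ i, fderiv ℝ (fderiv ℝ u) y (EuclideanSpace.basisFun (Fin m) ℝ i)
      (EuclideanSpace.basisFun (Fin m) ℝ i) := by
  refine Finset.sum_congr rfl fun i _ => ?_
  have h := hasFDerivAt_fderiv_of_contDiffOn_compl_zero hC hy
  have h' : HasFDerivAt (fun z => fderiv ℝ u z (EuclideanSpace.single i 1)) _ y :=
    (ContinuousLinearMap.apply ℝ ℝ (EuclideanSpace.single i (1 : ℝ))).hasFDerivAt.comp y h
  rw [h'.fderiv]
  simp

lemma abs_sub_div_norm_le_of_holderOnWith {E : Type*} [NormedAddCommGroup E] [NormedSpace ℝ E]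
    {f : E → ℝ} {C : NNReal} {α : ℝ} (hα : 0 ≤ α)
    (hf : HolderOnWith C ⟨α, hα⟩ f (sphere 0 1))
    (hhom : ∀ t : ℝ, 0 < t → ∀ y, y ≠ 0 → f (t • y) = t⁻¹ * f y) {x y : E} (hx : ‖x‖ = 1)
    (hy : y ≠ 0) : |f y - f x / ‖y‖| ≤ C * 2 ^ α * ‖y - x‖ ^ α * ‖y‖⁻¹ := by
  have hy' : 0 < ‖y‖ := norm_pos_iff.2 hy
  have hys : ‖‖y‖⁻¹ • y‖ = 1 := by simp [norm_smul, hy'.ne']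
  have h1 : f y = ‖y‖⁻¹ * f (‖y‖⁻¹ • y) := by
    rw [hhom _ (inv_pos.2 hy') y hy]
    field_simp
  have h2 : ‖‖y‖⁻¹ • y - x‖ ≤ 2 * ‖y - x‖ := by
    have h3 : ‖‖y‖⁻¹ • y - y‖ = |‖x‖ - ‖y‖| := by
      have : ‖y‖⁻¹ • y - y = (‖y‖⁻¹ - 1) • y := by module
      rw [this, norm_smul, Real.norm_eq_abs, hx, ← abs_norm y, ← abs_mul, abs_norm]
      congr 1
      field_simp
    have h4 := abs_norm_sub_norm_le x y
    rw [norm_sub_rev] at h4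
    calc _ ≤ ‖‖y‖⁻¹ • y - y‖ + ‖y - x‖ := norm_sub_le_norm_sub_add_norm_sub _ _ _
      _ ≤ _ := by linarith
  have h5 := hf.dist_le (x := ‖y‖⁻¹ • y) (y := x) (by simpa using hys) (by simpa using hx)
  rw [Real.dist_eq, dist_eq_norm] at h5
  change _ ≤ (C : ℝ) * ‖‖y‖⁻¹ • y - x‖ ^ α at h5
  calc |f y - f x / ‖y‖| = |f (‖y‖⁻¹ • y) - f x| * ‖y‖⁻¹ := by
        have h6 : f y - f x / ‖y‖ = (f (‖y‖⁻¹ • y) - f x) * ‖y‖⁻¹ := by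
          rw [h1]
          ring
        rw [h6, abs_mul, abs_inv, abs_norm]
    _ ≤ C * (2 * ‖y - x‖) ^ α * ‖y‖⁻¹ := by
        gcongr
        refine h5.trans ?_
        gcongr
    _ = _ := by
        rw [Real.mul_rpow two_pos.le (norm_nonneg _)]
        ring

/-- The second derivatives of `u` in directions tangent to the sphere, as singular integrals of
its Laplacian. -/
lemma integrable_and_integral_eq_fderiv_fderiv {n : ℕ} (hn : 1 ≤ n) {α : ℝ} (hα : 0 < α)
    {f u : EuclideanSpace ℝ (Fin (n + 1)) → ℝ} {C : NNReal}
    (hf : HolderOnWith C ⟨α, hα.le⟩ f (sphere 0 1))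
    (hhom : ∀ t : ℝ, 0 < t → ∀ y, y ≠ 0 → f (t • y) = t⁻¹ * f y)
    (hu : ∀ t : ℝ, 0 < t → ∀ y, u (t • y) = t * u y) (hC : ContDiffOn ℝ 2 u {0}ᶜ)
    (hlap : ∀ x, x ≠ 0 → laplacian u x = f x) {x ξ : EuclideanSpace ℝ (Fin (n + 1))}
    (hx : ‖x‖ = 1) (hξ : ‖ξ‖ = 1) (hξx : ⟪ξ, x⟫ = 0) :
    Integrable (fun y => (‖x - y‖ ^ 2 - (n + 1) * ⟪ξ, y⟫ ^ 2) / ‖x - y‖ ^ (n + 3) *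
        (f y - f x / ‖y‖)) ∧
      (1 / omega_n n) * (∫ y, (‖x - y‖ ^ 2 - (n + 1) * ⟪ξ, y⟫ ^ 2) / ‖x - y‖ ^ (n + 3) *
        (f y - f x / ‖y‖)) + f x / n = fderiv ℝ (fderiv ℝ u) x ξ ξ := by
  have hn' : (n : ℝ) ≠ 0 := by positivity
  have hx0 : x ≠ 0 := by
    rintro rfl
    simp at hx
  set e := EuclideanSpace.basisFun (Fin (n + 1)) ℝ with he
  set w : EuclideanSpace ℝ (Fin (n + 1)) → ℝ := fun z => u z - f x / n * ‖z‖ with hwdef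
  have hw : ∀ t : ℝ, 0 < t → ∀ y, w (t • y) = t * w y := fun t ht y => by
    simp only [hwdef]
    rw [hu t ht, norm_smul, Real.norm_of_nonneg ht.le]
    ring
  have hwC : ContDiffOn ℝ 2 w {0}ᶜ := hC.sub (contDiffOn_const.mul fun z hz =>
    (contDiffAt_norm ℝ hz).contDiffWithinAt)
  have htr : ∀ y, y ≠ 0 →
      ∑ i, fderiv ℝ (fderiv ℝ w) y (e i) (e i) = f y - f x / ‖y‖ := fun y hy => by
    have hy' : ‖y‖ ≠ 0 := norm_ne_zero_iff.2 hy
    have h1 : ∑ i, ⟪y, e i⟫ ^ 2 = ‖y‖ ^ 2 := e.sum_sq_inner_left y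
    have h2 := laplacian_eq_sum_fderiv_fderiv hC hy
    rw [hlap y hy, ← he] at h2
    simp only [hwdef, fderiv_fderiv_sub_smul_norm hC _ hy, Finset.sum_sub_distrib,
      ← Finset.mul_sum, e.norm_eq_one, h1, h2]
    simp
    field_simp
    ring
  obtain ⟨h1, h2⟩ := integral_hessKernel_mul_eq volume e hw hwC hn (by simp) hx hξ hα
    fun y hy => by
      rw [htr y hy]
      exact abs_sub_div_norm_le_of_holderOnWith hα.le hf hhom hx hy
  have hae : (fun y => hessKernel n 0 x ξ ξ y * ∑ i, fderiv ℝ (fderiv ℝ w) y (e i) (e i)) =ᵐ[volume]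
      fun y => (‖x - y‖ ^ 2 - (n + 1) * ⟪ξ, y⟫ ^ 2) / ‖x - y‖ ^ (n + 3) * (f y - f x / ‖y‖) := by
    have hne : ∀ z : EuclideanSpace ℝ (Fin (n + 1)), ∀ᵐ y, y ≠ z := fun z => by simp [ae_iff]
    filter_upwards [hne x, hne 0] with y hyx hy
    have hz : ‖y - x‖ ≠ 0 := norm_ne_zero_iff.2 (sub_ne_zero.2 hyx)
    rw [htr y hy, hessKernel, regNorm_zero, real_inner_self_eq_norm_sq, hξ, inner_sub_right, hξx,
      norm_sub_rev x y]
    congr 1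
    field_simp
    ring
  refine ⟨h1.congr hae, ?_⟩
  rw [← integral_congr_ae hae, h2, ← omega_n_eq, hwdef, fderiv_fderiv_sub_smul_norm hC _ hx0, hξ,
    hx, real_inner_comm, hξx]
  have := (omega_n_pos n).ne'
  field_simp
  ring

end SingularIntegral

end

/-- convexity criterion for Hölder continuous data. -/
theorem stmt_5 (n : ℕ) (hn : 2 ≤ n) (α : ℝ) (hα : 0 < α) (hα1 : α < 1)
    (f u : EuclideanSpace ℝ (Fin (n + 1)) → ℝ) (C : NNReal)
    (hf_pos : ∀ x ∈ sphere (0 : EuclideanSpace ℝ (Fin (n + 1))) 1, 0 < f x)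
    (hf_hold : HolderOnWith C ⟨α, hα.le⟩ f (sphere (0 : EuclideanSpace ℝ (Fin (n + 1))) 1))
    (hf_hom : ∀ t : ℝ, 0 < t → ∀ y : EuclideanSpace ℝ (Fin (n + 1)), y ≠ 0 →
      f (t • y) = t⁻¹ * f y)
    (hu_cont : Continuous u)
    (hu_hom : ∀ t : ℝ, 0 < t → ∀ y : EuclideanSpace ℝ (Fin (n + 1)), y ≠ 0 →
      u (t • y) = t * u y)
    (hu_C2 : ContDiffOn ℝ 2 u {(0 : EuclideanSpace ℝ (Fin (n + 1)))}ᶜ)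
    (hu_lap : ∀ x : EuclideanSpace ℝ (Fin (n + 1)), x ≠ 0 → laplacian u x = f x) :
    (∀ x ∈ sphere (0 : EuclideanSpace ℝ (Fin (n + 1))) 1,
      ∀ ξ ∈ sphere (0 : EuclideanSpace ℝ (Fin (n + 1))) 1, ⟪ξ, x⟫ = 0 →
        Integrable (fun y : EuclideanSpace ℝ (Fin (n + 1)) =>
          (‖x - y‖ ^ 2 - (n + 1) * ⟪ξ, y⟫ ^ 2) / ‖x - y‖ ^ (n + 3) * (f y - f x / ‖y‖)))
    ∧ (ConvexOn ℝ Set.univ u ↔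
        ∀ x ∈ sphere (0 : EuclideanSpace ℝ (Fin (n + 1))) 1,
          ∀ ξ ∈ sphere (0 : EuclideanSpace ℝ (Fin (n + 1))) 1, ⟪ξ, x⟫ = 0 →
            0 ≤ (1 / omega_n n) * (∫ y : EuclideanSpace ℝ (Fin (n + 1)),
                (‖x - y‖ ^ 2 - (n + 1) * ⟪ξ, y⟫ ^ 2) / ‖x - y‖ ^ (n + 3) * (f y - f x / ‖y‖))
              + f x / n) := by
  have hu0 : u 0 = 0 := by
    have hne : (EuclideanSpace.single 0 1 : EuclideanSpace ℝ (Fin (n + 1))) ≠ 0 := by simp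
    set y : EuclideanSpace ℝ (Fin (n + 1)) := EuclideanSpace.single 0 1
    have h1 : Filter.Tendsto (fun t : ℝ => u (t • y)) (nhdsWithin 0 (Ioi 0)) (nhds (u 0)) := by
      have : Continuous fun t : ℝ => u (t • y) := by fun_prop
      simpa using this.continuousAt.tendsto.mono_left (nhdsWithin_le_nhds (a := (0 : ℝ)))
    have h2 : Filter.Tendsto (fun t : ℝ => t * u y) (nhdsWithin 0 (Ioi 0)) (nhds 0) := by
      have : Continuous fun t : ℝ => t * u y := by fun_prop
      simpa using this.continuousAt.tendsto.mono_left (nhdsWithin_le_nhds (a := (0 : ℝ)))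
    refine tendsto_nhds_unique (h1.congr' ?_) h2
    filter_upwards [self_mem_nhdsWithin] with t ht
    exact hu_hom t ht y hne
  have hu : ∀ t : ℝ, 0 < t → ∀ y, u (t • y) = t * u y := fun t ht y => by
    by_cases hy : y = 0
    · simp [hy, hu0]
    · exact hu_hom t ht y hy
  have key : ∀ x ξ, ‖x‖ = 1 → ‖ξ‖ = 1 → ⟪ξ, x⟫ = 0 → _ := fun x ξ hx hξ hξx =>
    integrable_and_integral_eq_fderiv_fderiv (by omega) hα hf_hold hf_hom hu hu_C2 hu_lap
      (x := x) (ξ := ξ) hx hξ hξx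
  simp only [mem_sphere_zero_iff_norm]
  refine ⟨fun x hx ξ hξ hξx => (key x ξ hx hξ hξx).1, fun hconv x hx ξ hξ hξx => ?_, fun h => ?_⟩
  · rw [(key x ξ hx hξ hξx).2]
    exact fderiv_fderiv_nonneg_of_convexOn hu_C2 hconv hx hξx
  · refine convexOn_of_fderiv_fderiv_nonneg (by simp; omega) hu_cont hu_C2
      (fderiv_fderiv_nonneg_of_tangential hu hu_C2 fun x ξ hx hξ hξx => ?_)
    rw [← (key x ξ hx hξ hξx).2]
    exact h x hx ξ hξ hξx
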